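/- arXiv:2011.03293 — 7 statements merged into one kernel-verified Lean document; each statement's English description precedes it below -/
import Mathlib

section
/- Properties of the worst-case error bound: under the standing assumptions (I) and (II), one has 0 ≤ Θ < 1; for every y ∈ Y the optimal loss satisfies inf_{α ∈ D} ‖F(α) − y‖² ≤ Θ·‖y‖²; and there exists a worst-case unit label vector ȳ ∈ Y with ‖ȳ‖ = 1 and inf_{α ∈ D} ‖F(α) − ȳ‖² = Θ. -/
open Filter Metric
open scoped InnerProductSpace

noncomputable section

/-- The optimal value of the squared loss `inf_{α ∈ D} ‖F α - y‖²`. -/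
def lossInf {Y : Type} [NormedAddCommGroup Y] {m : ℕ}
    (D : Set (Fin m → ℝ)) (F : (Fin m → ℝ) → Y) (y : Y) : ℝ :=
  sInf ((fun α => ‖F α - y‖ ^ 2) '' D)

/-- The worst-case error bound `Θ = sup_{‖y‖ = 1} inf_{α ∈ D} ‖F α - y‖²`. -/
def Theta {Y : Type} [NormedAddCommGroup Y] {m : ℕ}
    (D : Set (Fin m → ℝ)) (F : (Fin m → ℝ) → Y) : ℝ :=
  sSup ((fun y => lossInf D F y) '' {y : Y | ‖y‖ = 1})

/-- The set of best approximations of `y` in `closure (F '' D)`. -/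
def bestApprox {Y : Type} [NormedAddCommGroup Y] {m : ℕ}
    (D : Set (Fin m → ℝ)) (F : (Fin m → ℝ) → Y) (y : Y) : Set Y :=
  {z | z ∈ closure (F '' D) ∧ ‖z - y‖ = Metric.infDist y (closure (F '' D))}

theorem lossInf_eq_infDist_sq {Y : Type} [NormedAddCommGroup Y] {m : ℕ}
    {D : Set (Fin m → ℝ)} (hD : D.Nonempty) (F : (Fin m → ℝ) → Y) (y : Y) :
    lossInf D F y = infDist y (F '' D) ^ 2 := by
  unfold lossInf
  apply le_antisymm
  · have hbdd : BddBelow ((fun α => ‖F α - y‖ ^ 2) '' D) :=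
      ⟨0, by rintro _ ⟨α, -, rfl⟩; positivity⟩
    refine (Real.sqrt_le_left infDist_nonneg).1 ((le_infDist (hD.image F)).2 ?_)
    rintro _ ⟨α, hα, rfl⟩
    refine (Real.sqrt_le_left dist_nonneg).2 ?_
    rw [dist_comm, dist_eq_norm]
    exact csInf_le hbdd ⟨α, hα, rfl⟩
  · refine le_csInf (hD.image _) ?_
    rintro _ ⟨α, hα, rfl⟩
    have h := infDist_le_dist_of_mem (x := y) (Set.mem_image_of_mem F hα)
    rw [dist_comm, dist_eq_norm] at h
    exact pow_le_pow_left₀ infDist_nonneg h 2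

open scoped Pointwise in
/-- The distance to a set that is stable under positive scaling is positively homogeneous. -/
theorem infDist_smul_of_cone {Y : Type*} [NormedAddCommGroup Y] [NormedSpace ℝ Y] {S : Set Y}
    (hS : ∀ y ∈ S, ∀ s : ℝ, 0 < s → s • y ∈ S) {c : ℝ} (hc : 0 < c) (y : Y) :
    infDist (c • y) S = c * infDist y S := by
  have hcS : c • S = S := by
    ext z
    rw [Set.mem_smul_set_iff_inv_smul_mem₀ hc.ne']
    refine ⟨fun h => ?_, fun h => hS z h _ (inv_pos.2 hc)⟩
    simpa [smul_smul, hc.ne'] using hS _ h c hc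
  have h := infDist_smul₀ hc.ne' S y
  rwa [hcS, Real.norm_of_nonneg hc.le] at h

theorem infDist_zero_of_cone {Y : Type*} [NormedAddCommGroup Y] [NormedSpace ℝ Y] {S : Set Y}
    (hS : ∀ y ∈ S, ∀ s : ℝ, 0 < s → s • y ∈ S) : infDist 0 S = 0 := by
  have h := infDist_smul_of_cone hS two_pos 0
  rw [smul_zero] at h
  linarith

theorem theta_properties {Y : Type} [NormedAddCommGroup Y] [InnerProductSpace ℝ Y]
    [FiniteDimensional ℝ Y] [Nontrivial Y] {m : ℕ}
    (D : Set (Fin m → ℝ)) (hD : D.Nonempty) (F : (Fin m → ℝ) → Y)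
    (hcone : ∀ y ∈ F '' D, ∀ s : ℝ, 0 < s → s • y ∈ F '' D)
    (hexpr : ∀ y : Y, y ≠ 0 → lossInf D F y < ‖y‖ ^ 2) :
    0 ≤ Theta D F ∧ Theta D F < 1 ∧
    (∀ y : Y, lossInf D F y ≤ Theta D F * ‖y‖ ^ 2) ∧
    (∃ ybar : Y, ‖ybar‖ = 1 ∧ lossInf D F ybar = Theta D F) := by
  have hL := lossInf_eq_infDist_sq hD F
  have hcont : Continuous (lossInf D F) := by
    rw [funext hL]
    exact (continuous_infDist_pt _).pow 2
  have hsphere : {y : Y | ‖y‖ = 1} = sphere 0 1 := by ext; simp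
  have hcompact : IsCompact {y : Y | ‖y‖ = 1} := hsphere ▸ isCompact_sphere 0 1
  have hne : {y : Y | ‖y‖ = 1}.Nonempty := exists_norm_eq Y zero_le_one
  obtain ⟨z, hz, hzT⟩ := hcompact.exists_sSup_image_eq hne hcont.continuousOn
  have hz1 : ‖z‖ = 1 := hz
  change Theta D F = lossInf D F z at hzT
  refine ⟨?_, ?_, fun y => ?_, z, hz, hzT.symm⟩
  · rw [hzT, hL]
    positivity
  · have h := hexpr z (norm_ne_zero_iff.1 (by simp [hz1]))
    rwa [hz1, one_pow, ← hzT] at h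
  · rcases eq_or_ne y 0 with rfl | hy
    · simp [hL, infDist_zero_of_cone hcone]
    · have hy' : 0 < ‖y‖ := norm_pos_iff.2 hy
      have hu : lossInf D F (‖y‖⁻¹ • y) ≤ Theta D F :=
        le_csSup (hcompact.image hcont).bddAbove
          ⟨_, by simp [norm_smul, hy'.ne'], rfl⟩
      have hscale : lossInf D F y = lossInf D F (‖y‖⁻¹ • y) * ‖y‖ ^ 2 := by
        rw [hL, hL, infDist_smul_of_cone hcone (inv_pos.2 hy')]
        field_simp
      rw [hscale]
      gcongr
end
end

section
/- A variant of Jung's inequality: let H ⊆ Y be an affine subspace of dimension d with 1 ≤ d ≤ dim Y, let ȳ ∈ H, let E ⊆ H be a compact set, and let r > 0 be such that ȳ lies in the convex hull of E and ‖ȳ − z‖ = r for all z ∈ E. Then sup_{z₁, z₂ ∈ E} ‖z₁ − z₂‖ ≥ ((2·d + 2)/d)^{1/2}·r. -/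
noncomputable section

/-- If the origin is a convex combination of vectors of norm `r`, then the weighted mean of their
squared distances to any vector of norm `r` is `2 * r ^ 2`. -/
theorem sum_mul_norm_sub_sq_of_norm_eq {ι Y : Type*} [Fintype ι] [NormedAddCommGroup Y]
    [InnerProductSpace ℝ Y] {v : ι → Y} {w : ι → ℝ} {r : ℝ} (hv : ∀ i, ‖v i‖ = r)
    (hw : ∑ i, w i = 1) (hwv : ∑ i, w i • v i = 0) {x : Y} (hx : ‖x‖ = r) :
    ∑ j, w j * ‖x - v j‖ ^ 2 = 2 * r ^ 2 := by
  have hinner : ∑ j, w j * inner ℝ x (v j) = 0 := by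
    have h := congrArg (inner ℝ x) hwv
    simpa only [inner_sum, real_inner_smul_right, inner_zero_right] using h
  calc ∑ j, w j * ‖x - v j‖ ^ 2
      = ∑ j, (w j * (2 * r ^ 2) - 2 * (w j * inner ℝ x (v j))) := by
        refine Finset.sum_congr rfl fun j _ => ?_
        rw [norm_sub_sq_real, hx, hv]
        ring
    _ = 2 * r ^ 2 := by
        rw [Finset.sum_sub_distrib, ← Finset.sum_mul, ← Finset.mul_sum, hinner, hw]
        ring

/-- If the origin is a convex combination of finitely many vectors of norm `r` whose mutual
distances are at most `D`, then `D` satisfies Jung's bound in terms of the number of vectors. -/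
theorem two_mul_card_mul_sq_le_of_norm_sub_le {ι Y : Type*} [Fintype ι] [NormedAddCommGroup Y]
    [InnerProductSpace ℝ Y] {v : ι → Y} {w : ι → ℝ} {r D : ℝ} (hv : ∀ i, ‖v i‖ = r)
    (hw0 : ∀ i, 0 ≤ w i) (hw : ∑ i, w i = 1) (hwv : ∑ i, w i • v i = 0)
    (hD : ∀ i j, ‖v i - v j‖ ≤ D) :
    2 * (Fintype.card ι : ℝ) * r ^ 2 ≤ ((Fintype.card ι : ℝ) - 1) * D ^ 2 := by
  classical
  have hpoint : ∀ i, 2 * r ^ 2 ≤ (1 - w i) * D ^ 2 := fun i => by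
    rw [← sum_mul_norm_sub_sq_of_norm_eq hv hw hwv (hv i), ← hw,
      ← Finset.add_sum_erase _ _ (Finset.mem_univ i),
      ← Finset.add_sum_erase _ w (Finset.mem_univ i), add_sub_cancel_left, Finset.sum_mul]
    simp only [sub_self, norm_zero, ne_eq, OfNat.ofNat_ne_zero, not_false_eq_true, zero_pow,
      mul_zero, zero_add]
    exact Finset.sum_le_sum fun j _ => mul_le_mul_of_nonneg_left
      (pow_le_pow_left₀ (norm_nonneg _) (hD i j) 2) (hw0 j)
  have hsum := Finset.sum_le_sum fun i (_ : i ∈ Finset.univ) => hpoint i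
  rw [← Finset.sum_mul, ← Finset.sum_mul, Finset.sum_sub_distrib, hw] at hsum
  simp only [Finset.sum_const, Finset.card_univ, nsmul_eq_mul, mul_one] at hsum
  linarith

theorem jung_variant {Y : Type} [NormedAddCommGroup Y] [InnerProductSpace ℝ Y]
    [FiniteDimensional ℝ Y]
    (H : AffineSubspace ℝ Y) (d : ℕ) (hd1 : 1 ≤ d) (hd2 : d ≤ Module.finrank ℝ Y)
    (hHd : Module.finrank ℝ H.direction = d)
    (ybar : Y) (hyH : ybar ∈ H)
    (E : Set Y) (hEH : E ⊆ (H : Set Y)) (hE : IsCompact E)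
    (r : ℝ) (hr : 0 < r)
    (hconv : ybar ∈ convexHull ℝ E)
    (hdist : ∀ z ∈ E, ‖ybar - z‖ = r) :
    Real.sqrt ((2 * (d : ℝ) + 2) / d) * r ≤
      sSup {t : ℝ | ∃ z₁ ∈ E, ∃ z₂ ∈ E, t = ‖z₁ - z₂‖} := by
  set D := sSup {t : ℝ | ∃ z₁ ∈ E, ∃ z₂ ∈ E, t = ‖z₁ - z₂‖}
  have hbdd : BddAbove {t : ℝ | ∃ z₁ ∈ E, ∃ z₂ ∈ E, t = ‖z₁ - z₂‖} := by
    refine ⟨Metric.diam E, ?_⟩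
    rintro _ ⟨z₁, h₁, z₂, h₂, rfl⟩
    rw [← dist_eq_norm]
    exact Metric.dist_le_diam_of_mem hE.isBounded h₁ h₂
  have hle : ∀ z₁ ∈ E, ∀ z₂ ∈ E, ‖z₁ - z₂‖ ≤ D := fun z₁ h₁ z₂ h₂ =>
    le_csSup hbdd ⟨z₁, h₁, z₂, h₂, rfl⟩
  obtain ⟨ι, _, z, w, hzE, hind, hw0, hw, hwz⟩ := eq_pos_convex_span_of_mem_convexHull hconv
  have hz : ∀ i, z i ∈ E := fun i => hzE ⟨i, rfl⟩
  have hne : Nonempty ι := by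
    by_contra h
    rw [not_nonempty_iff] at h
    simp at hw
  have hD0 : 0 ≤ D := (norm_nonneg _).trans (hle _ (hz hne.some) _ (hz hne.some))
  have hcard : Fintype.card ι ≤ d + 1 := by
    refine hind.card_le_finrank_succ.trans (Nat.add_le_add_right ?_ 1)
    rw [← hHd]
    exact Submodule.finrank_mono (vectorSpan_mono ℝ (hzE.trans hEH))
  have hjung := two_mul_card_mul_sq_le_of_norm_sub_le (v := fun i => z i - ybar) (D := D)
    (fun i => by rw [norm_sub_rev]; exact hdist _ (hz i)) (fun i => (hw0 i).le) hw
    (by simp only [smul_sub]; rw [Finset.sum_sub_distrib, ← Finset.sum_smul, hw, hwz]; simp)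
    (fun i j => by simpa using hle _ (hz i) _ (hz j))
  have hn : (0 : ℝ) < Fintype.card ι := by exact_mod_cast Fintype.card_pos
  have hd : (0 : ℝ) < d := by exact_mod_cast hd1
  have hcard' : (Fintype.card ι : ℝ) ≤ d + 1 := by exact_mod_cast hcard
  have hkey : (2 * (d : ℝ) + 2) * r ^ 2 ≤ d * D ^ 2 := by
    refine le_of_mul_le_mul_left ?_ hn
    linarith [mul_le_mul_of_nonneg_left hjung (by positivity : (0 : ℝ) ≤ d + 1),
      mul_le_mul_of_nonneg_right hcard' (sq_nonneg D)]
  refine (sq_le_sq₀ (by positivity) hD0).mp ?_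
  rw [mul_pow, Real.sq_sqrt (by positivity), div_mul_eq_mul_div, div_le_iff₀ hd]
  linarith
end
end

section
/- Nonuniqueness of best approximations: assume additionally closure(S) ≠ Y. Then the set {y ∈ Y : P(y) contains at least two distinct elements} is uncountable; in fact there exists ȳ ∈ Y with ȳ ≠ 0 such that P(s·ȳ) contains at least two distinct elements for every s > 0. -/
open Filter Metric
open scoped InnerProductSpace

noncomputable section

/-- A compact proper subset of the unit sphere that meets every open half-space through the origin
has a direction of unit length in which its support function is attained at two distinct points. -/
theorem IsCompact.exists_two_isMaxOn_inner {Y : Type*} [NormedAddCommGroup Y]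
    [InnerProductSpace ℝ Y] [FiniteDimensional ℝ Y] {C : Set Y} (hC : IsCompact C)
    (hCs : ∀ z ∈ C, ‖z‖ = 1) (hpos : ∀ y : Y, y ≠ 0 → ∃ z ∈ C, 0 < ⟪y, z⟫_ℝ)
    (hne : ∃ y : Y, ‖y‖ = 1 ∧ y ∉ C) :
    ∃ y : Y, ‖y‖ = 1 ∧ ∃ z₁ ∈ C, ∃ z₂ ∈ C, z₁ ≠ z₂ ∧
      IsMaxOn (fun z => ⟪y, z⟫_ℝ) C z₁ ∧ IsMaxOn (fun z => ⟪y, z⟫_ℝ) C z₂ := by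
  obtain ⟨y₀, hy₀, hy₀C⟩ := hne
  have hy₀0 : y₀ ≠ 0 := by
    rintro rfl
    simp at hy₀
  have hCne : C.Nonempty := let ⟨z, hz, _⟩ := hpos y₀ hy₀0; ⟨z, hz⟩
  set h : Y → ℝ := fun y => sSup ((fun z => ⟪y, z⟫_ℝ) '' C)
  have hcont : Continuous h :=
    hC.continuous_sSup (f := fun y z => ⟪y, z⟫_ℝ) (by fun_prop)
  have hmax : ∀ y, ∃ z ∈ C, h y = ⟪y, z⟫_ℝ ∧ ∀ z' ∈ C, ⟪y, z'⟫_ℝ ≤ ⟪y, z⟫_ℝ := fun y =>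
    hC.exists_sSup_image_eq_and_ge hCne (by fun_prop)
  obtain ⟨y, hy, hmin⟩ := (isCompact_sphere (0 : Y) 1).exists_isMinOn
    ⟨y₀, by simpa using hy₀⟩ hcont.continuousOn
  have hy1 : ‖y‖ = 1 := by simpa using hy
  have hy0 : y ≠ 0 := by
    rintro rfl
    simp at hy1
  obtain ⟨p, hpC, hpr, hp⟩ := hmax y
  set r := ⟪y, p⟫_ℝ with hr
  have hr0 : 0 < r := by
    obtain ⟨z, hz, hz0⟩ := hpos y hy0
    exact hz0.trans_le (hp z hz)
  have hmin' : ∀ u : Y, ‖u‖ = 1 → r ≤ h u := fun u hu => by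
    rw [← hpr]
    exact hmin (by simpa using hu)
  have hr1 : r < 1 := by
    obtain ⟨z, hzC, hz, -⟩ := hmax y₀
    refine (hmin' y₀ hy₀).trans_lt (hz ▸ ?_)
    refine (inner_lt_one_iff_real_of_norm_eq_one hy₀ (hCs z hzC)).2 ?_
    rintro rfl
    exact hy₀C hzC
  set w := p - r • y with hw
  have hyy : ⟪y, y⟫_ℝ = 1 := by rw [real_inner_self_eq_norm_sq, hy1]; norm_num
  have hpp : ⟪p, p⟫_ℝ = 1 := by rw [real_inner_self_eq_norm_sq, hCs p hpC]; norm_num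
  have hyw : ⟪y, w⟫_ℝ = 0 := by
    rw [hw, inner_sub_right, real_inner_smul_right, hyy, ← hr]; ring
  have hwp : 0 < ⟪w, p⟫_ℝ := by
    rw [hw, inner_sub_left, real_inner_smul_left, hpp, ← hr]
    nlinarith
  -- Moving `y` away from `p` cannot lower the support function, so other points of `C` take over.
  have key : ∀ t : ℝ, 0 < t → ∃ z ∈ C, ⟪w, z⟫_ℝ ≤ 0 ∧ r - t * ‖w‖ ≤ ⟪y, z⟫_ℝ := by
    intro t ht
    have hN : 1 ≤ ‖y - t • w‖ := by
      have : ‖y - t • w‖ ^ 2 = 1 + (t * ‖w‖) ^ 2 := by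
        rw [norm_sub_sq_real, real_inner_smul_right, hyw, hy1, norm_smul,
          Real.norm_eq_abs, abs_of_pos ht]
        ring
      nlinarith [norm_nonneg (y - t • w), sq_nonneg (t * ‖w‖)]
    have hN0 : 0 < ‖y - t • w‖ := one_pos.trans_le hN
    obtain ⟨z, hzC, hz, -⟩ := hmax (‖y - t • w‖⁻¹ • (y - t • w))
    have h1 := hmin' (‖y - t • w‖⁻¹ • (y - t • w)) (by
      rw [norm_smul, norm_inv, norm_norm, inv_mul_cancel₀ hN0.ne'])
    rw [hz, real_inner_smul_left, inv_mul_eq_div, le_div_iff₀ hN0, inner_sub_left,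
      real_inner_smul_left] at h1
    have h2 : r ≤ ⟪y, z⟫_ℝ - t * ⟪w, z⟫_ℝ := by nlinarith
    have h3 : -‖w‖ ≤ ⟪w, z⟫_ℝ := by
      have := (abs_le.1 (abs_real_inner_le_norm w z)).1
      rwa [hCs z hzC, mul_one] at this
    refine ⟨z, hzC, ?_, by nlinarith⟩
    have := hp z hzC
    by_contra! hcon
    nlinarith [mul_pos ht hcon]
  have hC₀ : IsCompact (C ∩ {z | ⟪w, z⟫_ℝ ≤ 0}) :=
    hC.inter_right (isClosed_le (by fun_prop) continuous_const)
  obtain ⟨q, ⟨hqC, hwq⟩, hq⟩ := hC₀.exists_isMaxOn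
    (let ⟨z, hz, hz', _⟩ := key 1 one_pos; ⟨z, hz, hz'⟩)
    (f := fun z => ⟪y, z⟫_ℝ) (by fun_prop)
  have hrq : r ≤ ⟪y, q⟫_ℝ := by
    refine le_of_forall_pos_le_add fun ε hε => ?_
    obtain ⟨z, hz, hz', hz''⟩ := key (ε / (‖w‖ + 1)) (by positivity)
    have h1 : ⟪y, z⟫_ℝ ≤ ⟪y, q⟫_ℝ := hq ⟨hz, hz'⟩
    have h2 : ε / (‖w‖ + 1) * ‖w‖ ≤ ε := by
      rw [div_mul_eq_mul_div, div_le_iff₀ (by positivity)]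
      nlinarith [norm_nonneg w]
    linarith
  refine ⟨y, hy1, p, hpC, q, hqC, ?_, fun z hz => hp z hz, fun z hz => (hp z hz).trans hrq⟩
  rintro rfl
  exact hwp.not_ge hwq

/-- Projecting `y` onto the ray through a unit vector of a cone that maximizes the inner product
with `y` realizes the distance from `y` to the cone. -/
theorem norm_inner_smul_sub_eq_infDist {Y : Type*} [NormedAddCommGroup Y]
    [InnerProductSpace ℝ Y] {K : Set Y} (hK : ∀ k ∈ K, ∀ s : ℝ, 0 < s → s • k ∈ K) {y z : Y}
    (hzK : z ∈ K) (hz : ‖z‖ = 1) (hyz : 0 < ⟪y, z⟫_ℝ)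
    (hmax : ∀ k ∈ K, ‖k‖ = 1 → ⟪y, k⟫_ℝ ≤ ⟪y, z⟫_ℝ) :
    ‖⟪y, z⟫_ℝ • z - y‖ = infDist y K := by
  set c := ⟪y, z⟫_ℝ with hc
  refine le_antisymm ((le_infDist ⟨z, hzK⟩).2 fun k hk => ?_) ?_
  · rw [dist_comm, dist_eq_norm]
    refine le_of_sq_le_sq ?_ (norm_nonneg _)
    have hyk : ⟪y, k⟫_ℝ ≤ c * ‖k‖ := by
      rcases eq_or_ne k 0 with rfl | hk0
      · simp
      · have hk' : 0 < ‖k‖ := norm_pos_iff.2 hk0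
        have := hmax (‖k‖⁻¹ • k) (hK k hk _ (by positivity))
          (by rw [norm_smul, norm_inv, norm_norm, inv_mul_cancel₀ hk'.ne'])
        rwa [real_inner_smul_right, inv_mul_eq_div, div_le_iff₀ hk'] at this
    rw [norm_sub_sq_real, norm_sub_sq_real, real_inner_smul_left, norm_smul, hz,
      real_inner_comm, ← hc, real_inner_comm, Real.norm_eq_abs, mul_one, sq_abs]
    nlinarith [sq_nonneg (‖k‖ - c)]
  · rw [← dist_eq_norm, dist_comm]
    exact infDist_le_dist_of_mem (hK z hzK _ hyz)

theorem bestApprox_nonuniqueness {Y : Type} [NormedAddCommGroup Y]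
    [InnerProductSpace ℝ Y] [FiniteDimensional ℝ Y] [Nontrivial Y] {m : ℕ}
    (D : Set (Fin m → ℝ)) (hD : D.Nonempty) (F : (Fin m → ℝ) → Y)
    (hcone : ∀ y ∈ F '' D, ∀ s : ℝ, 0 < s → s • y ∈ F '' D)
    (hexpr : ∀ y : Y, y ≠ 0 → lossInf D F y < ‖y‖ ^ 2)
    (hcl : closure (F '' D) ≠ Set.univ) :
    ¬ Set.Countable {y : Y | ∃ z₁ ∈ bestApprox D F y, ∃ z₂ ∈ bestApprox D F y, z₁ ≠ z₂} ∧
    ∃ ybar : Y, ybar ≠ 0 ∧ ∀ s : ℝ, 0 < s →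
      ∃ z₁ ∈ bestApprox D F (s • ybar), ∃ z₂ ∈ bestApprox D F (s • ybar), z₁ ≠ z₂ := by
  set K := closure (F '' D)
  have hK : ∀ k ∈ K, ∀ s : ℝ, 0 < s → s • k ∈ K := fun k hk s hs =>
    map_mem_closure (continuous_const_smul s) hk fun y hy => hcone y hy s hs
  have hnorm : ∀ y : Y, y ≠ 0 → ‖‖y‖⁻¹ • y‖ = 1 := fun y hy => by
    rw [norm_smul, norm_inv, norm_norm, inv_mul_cancel₀ (norm_ne_zero_iff.2 hy)]
  have hpos : ∀ y : Y, y ≠ 0 → ∃ z ∈ K ∩ sphere 0 1, 0 < ⟪y, z⟫_ℝ := by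
    intro y hy
    obtain ⟨_, ⟨α, hα, rfl⟩, hlt⟩ := exists_lt_of_csInf_lt (hD.image _) (hexpr y hy)
    have hin : 0 < ⟪y, F α⟫_ℝ := by
      simp only [norm_sub_sq_real] at hlt
      rw [real_inner_comm]
      nlinarith [sq_nonneg ‖F α‖]
    have hF : F α ≠ 0 := fun h => by simp [h] at hin
    have hF' : 0 < ‖F α‖⁻¹ := inv_pos.2 (norm_pos_iff.2 hF)
    refine ⟨‖F α‖⁻¹ • F α, ⟨hK _ (subset_closure ⟨α, hα, rfl⟩) _ hF', ?_⟩, ?_⟩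
    · simpa using hnorm _ hF
    · rw [real_inner_smul_right]
      exact mul_pos hF' hin
  have hne : ∃ y : Y, ‖y‖ = 1 ∧ y ∉ K ∩ sphere 0 1 := by
    by_contra! hall
    have hsub : ({0}ᶜ : Set Y) ⊆ K := fun y hy => by
      have := hK _ (hall _ (hnorm y hy)).1 ‖y‖ (norm_pos_iff.2 hy)
      rwa [smul_smul, mul_inv_cancel₀ (norm_ne_zero_iff.2 hy), one_smul] at this
    have : (nhdsWithin (0 : Y) {0}ᶜ).NeBot := Module.punctured_nhds_neBot ℝ Y 0
    have hdense : Dense K := (dense_compl_singleton (0 : Y)).mono hsub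
    exact hcl (closure_closure.symm.trans hdense.closure_eq)
  obtain ⟨y, hy1, z₁, hz₁, z₂, hz₂, hz, hm₁, hm₂⟩ :=
    ((isCompact_sphere (0 : Y) 1).inter_left isClosed_closure).exists_two_isMaxOn_inner
      (fun z hz => by simpa using hz.2) hpos hne
  have hy0 : y ≠ 0 := by
    rintro rfl
    simp at hy1
  obtain ⟨z₀, hz₀, hz₀pos⟩ := hpos y hy0
  have hbest : ∀ z ∈ K ∩ sphere 0 1, IsMaxOn (fun z => ⟪y, z⟫_ℝ) (K ∩ sphere 0 1) z →
      ∀ s : ℝ, 0 < s → (s * ⟪y, z⟫_ℝ) • z ∈ bestApprox D F (s • y) := by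
    intro z hz hm s hs
    have hyz : 0 < ⟪y, z⟫_ℝ := hz₀pos.trans_le (hm hz₀)
    refine ⟨hK z hz.1 _ (mul_pos hs hyz), ?_⟩
    rw [← real_inner_smul_left]
    refine norm_inner_smul_sub_eq_infDist hK hz.1 (by simpa using hz.2) ?_ fun k hk hk1 => ?_
    · rw [real_inner_smul_left]
      exact mul_pos hs hyz
    · rw [real_inner_smul_left, real_inner_smul_left]
      exact mul_le_mul_of_nonneg_left (hm ⟨hk, by simpa using hk1⟩) hs.le
  have heq : ⟪y, z₁⟫_ℝ = ⟪y, z₂⟫_ℝ := le_antisymm (hm₂ hz₁) (hm₁ hz₂)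
  have htwo : ∀ s : ℝ, 0 < s →
      ∃ z₁ ∈ bestApprox D F (s • y), ∃ z₂ ∈ bestApprox D F (s • y), z₁ ≠ z₂ := by
    intro s hs
    refine ⟨_, hbest z₁ hz₁ hm₁ s hs, _, hbest z₂ hz₂ hm₂ s hs, ?_⟩
    rw [← heq]
    exact fun h => hz (smul_right_injective Y
      (mul_pos hs (hz₀pos.trans_le (hm₁ hz₀))).ne' h)
  refine ⟨fun hcount => ?_, y, hy0, htwo⟩
  have hIoi : (Set.Ioi (0 : ℝ)).Countable :=
    (hcount.preimage (smul_left_injective ℝ hy0)).mono fun s hs => htwo s hs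
  have := Cardinal.mk_Ioi_real 0 ▸ Cardinal.le_aleph0_iff_set_countable.2 hIoi
  exact this.not_gt Cardinal.aleph0_lt_continuum
end
end

section
/- Relation between set-valuedness and spurious minima/basins: assume additionally closure(S) ≠ Y, that F : D → Y is continuous (D with the subspace topology of ℝ^m), and that the image of the map y ↦ card(P(y)) (cardinality, with values in ℕ ∪ {∞}) is not equal to the two-element set {1, ∞}. Then there exist a nonempty open cone K ⊆ Y (K open, nonempty, and s·y ∈ K whenever y ∈ K and s > 0) and an integer M ≥ 2 such that for every y_d ∈ K there are nonempty pairwise disjoint sets D₁, …, D_M, each closed in the subspace topology of D, satisfying inf_{α ∈ D₁} L_{y_d}(α) < inf_{α ∈ D_i} L_{y_d}(α) for every i = 2, …, M, and sup_{α ∈ D₁ ∪ … ∪ D_M} L_{y_d}(α) < L_{y_d}(α̃) for every α̃ ∈ D \ (D₁ ∪ … ∪ D_M). -/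
open Filter Metric
open scoped InnerProductSpace

noncomputable section

/-- Two maximizers of `⟪y, ·⟫` among the unit vectors of a cone `C` coincide, provided that the
maximum is positive and `y` has at most one nearest point in `C`. -/
lemma eq_of_isMaxOn_inner_of_nearest_unique {Y : Type*} [NormedAddCommGroup Y]
    [InnerProductSpace ℝ Y] {C : Set Y} (hsmul : ∀ z ∈ C, ∀ s : ℝ, 0 ≤ s → s • z ∈ C) {y : Y}
    (huniq : {z | z ∈ C ∧ ‖z - y‖ = infDist y C}.Subsingleton) {a b : Y}
    (ha : a ∈ C) (ha1 : ‖a‖ = 1) (hb : b ∈ C) (hb1 : ‖b‖ = 1) (hpos : 0 < ⟪y, a⟫_ℝ)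
    (hmax : ∀ c ∈ C, ‖c‖ = 1 → ⟪y, c⟫_ℝ ≤ ⟪y, a⟫_ℝ) (hab : ⟪y, b⟫_ℝ = ⟪y, a⟫_ℝ) : a = b := by
  set h := ⟪y, a⟫_ℝ
  have hnorm : ∀ c : Y, ‖c‖ = 1 → ⟪y, c⟫_ℝ = h → ‖h • c - y‖ ^ 2 = ‖y‖ ^ 2 - h ^ 2 := by
    intro c hc hc'
    rw [norm_sub_sq_real, norm_smul, hc, inner_smul_left, real_inner_comm, hc']
    simp only [Real.norm_eq_abs, mul_one, sq_abs, conj_trivial]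
    ring
  have hlow : ∀ z ∈ C, ‖y‖ ^ 2 - h ^ 2 ≤ ‖z - y‖ ^ 2 := by
    intro z hz
    have hzy : ⟪y, z⟫_ℝ ≤ ‖z‖ * h := by
      rcases eq_or_ne z 0 with rfl | hz0
      · simp
      · have hz0' : 0 < ‖z‖ := norm_pos_iff.2 hz0
        have := hmax (‖z‖⁻¹ • z) (hsmul z hz _ (by positivity)) (norm_smul_inv_norm hz0)
        rw [inner_smul_right, inv_mul_le_iff₀ hz0'] at this
        exact this
    rw [norm_sub_sq_real, real_inner_comm]
    nlinarith [sq_nonneg (‖z‖ - h)]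
  have hmem : ∀ c ∈ C, ‖c‖ = 1 → ⟪y, c⟫_ℝ = h →
      h • c ∈ {z | z ∈ C ∧ ‖z - y‖ = infDist y C} := by
    intro c hc hc1 hch
    have hcC := hsmul c hc h hpos.le
    refine ⟨hcC, le_antisymm ((le_infDist ⟨_, hcC⟩).2 fun z hz => ?_) ?_⟩
    · rw [dist_comm, dist_eq_norm]
      refine le_of_sq_le_sq ?_ (norm_nonneg _)
      rw [hnorm c hc1 hch]
      exact hlow z hz
    · rw [← dist_eq_norm, dist_comm]
      exact infDist_le_dist_of_mem hcC
  exact smul_right_injective Y hpos.ne' (huniq (hmem a ha ha1 rfl) (hmem b hb hb1 hab))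

/-- If a linear functional has a strict maximizer `a` on a compact set `A`, then `a` is also its
only maximizer on the closed convex hull of `A`. -/
lemma eq_of_mem_closure_convexHull_of_forall_lt {Y : Type*} [NormedAddCommGroup Y]
    [NormedSpace ℝ Y] {A : Set Y} (hA : IsCompact A) (f : StrongDual ℝ Y) {a x : Y}
    (hlt : ∀ b ∈ A, b ≠ a → f b < f a)
    (hx : x ∈ closure (convexHull ℝ A)) (hfx : f a ≤ f x) : x = a := by
  obtain ⟨R, hR⟩ := hA.isBounded.subset_closedBall a
  suffices H : ∀ η > 0, ‖x - a‖ ≤ η from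
    sub_eq_zero.1 (norm_le_zero_iff.1 (le_of_forall_pos_le_add fun η hη => by simpa using H η hη))
  intro η hη
  obtain ⟨k, hk, hAk⟩ : ∃ k : ℝ, 0 ≤ k ∧ ∀ b ∈ A, ‖b - a‖ ≤ η + k * (f a - f b) := by
    have hfle : ∀ b ∈ A, f b ≤ f a := fun b hb => by
      rcases eq_or_ne b a with rfl | h
      · exact le_rfl
      · exact (hlt b hb h).le
    have hA' : IsCompact (A \ ball a η) := hA.diff isOpen_ball
    rcases (A \ ball a η).eq_empty_or_nonempty with he | hne
    · refine ⟨0, le_rfl, fun b hb => ?_⟩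
      have := Set.sdiff_eq_empty.1 he hb
      rw [mem_ball, dist_eq_norm] at this
      linarith
    · obtain ⟨c, hc, hcmax⟩ := hA'.exists_isMaxOn hne f.continuous.continuousOn
      have hca : f c < f a := hlt c hc.1 (by rintro rfl; exact hc.2 (mem_ball_self hη))
      have hgap : 0 < f a - f c := sub_pos.2 hca
      refine ⟨|R| / (f a - f c), by positivity, fun b hb => ?_⟩
      by_cases hbη : b ∈ ball a η
      · rw [mem_ball, dist_eq_norm] at hbη
        have : 0 ≤ |R| / (f a - f c) * (f a - f b) :=
          mul_nonneg (by positivity) (sub_nonneg.2 (hfle b hb))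
        linarith
      · have h1 : f b ≤ f c := hcmax ⟨hb, hbη⟩
        have h2 : ‖b - a‖ ≤ |R| := by
          rw [← dist_eq_norm]; exact (hR hb).trans (le_abs_self R)
        have h3 : |R| ≤ |R| / (f a - f c) * (f a - f b) := by
          rw [div_mul_eq_mul_div, le_div_iff₀ hgap]
          exact mul_le_mul_of_nonneg_left (by linarith) (abs_nonneg R)
        linarith
  have hclosed : IsClosed {w : Y | ‖w - a‖ ≤ η + k * (f a - f w)} :=
    isClosed_le (by fun_prop) (by fun_prop)
  have hconv : Convex ℝ {w : Y | ‖w - a‖ ≤ η + k * (f a - f w)} := by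
    intro u hu v hv s t hs ht hst
    simp only [Set.mem_ofPred_eq] at hu hv ⊢
    have he : s • u + t • v - a = s • (u - a) + t • (v - a) := by
      have : a = (s + t) • a := by rw [hst, one_smul]
      conv_lhs => rw [this]
      module
    have h1 : ‖s • u + t • v - a‖ ≤ s * ‖u - a‖ + t * ‖v - a‖ := by
      rw [he]
      refine (norm_add_le _ _).trans ?_
      rw [norm_smul, norm_smul, Real.norm_of_nonneg hs, Real.norm_of_nonneg ht]
    simp only [map_add, map_smul, smul_eq_mul]
    obtain rfl : t = 1 - s := by linarith
    nlinarith [mul_le_mul_of_nonneg_left hu hs, mul_le_mul_of_nonneg_left hv ht]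
  have hxm : ‖x - a‖ ≤ η + k * (f a - f x) :=
    closure_minimal (convexHull_min hAk hconv) hclosed hx
  nlinarith [mul_nonneg hk (sub_nonneg.2 hfx)]

/-- If every nonzero vector is approximated by the closed cone `C` better than by `0`, then the
origin is interior to the closed convex hull of the unit vectors of `C`. -/
lemma zero_mem_interior_closure_convexHull_inter_sphere {Y : Type*} [NormedAddCommGroup Y]
    [InnerProductSpace ℝ Y] [FiniteDimensional ℝ Y] [Nontrivial Y] {C : Set Y} (hC : IsClosed C)
    (hsmul : ∀ z ∈ C, ∀ s : ℝ, 0 ≤ s → s • z ∈ C)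
    (hexpr : ∀ y : Y, y ≠ 0 → ∃ z ∈ C, ‖z - y‖ < ‖y‖) :
    (0 : Y) ∈ interior (closure (convexHull ℝ (C ∩ sphere 0 1))) := by
  obtain ⟨y₀, hy₀⟩ := exists_ne (0 : Y)
  have hne : C.Nonempty := let ⟨z, hz, _⟩ := hexpr y₀ hy₀; ⟨z, hz⟩
  have hproper : ProperSpace Y := FiniteDimensional.proper_real Y
  obtain ⟨y₁, hy₁, hmax⟩ := (isCompact_sphere (0 : Y) 1).exists_isMaxOn
    (NormedSpace.sphere_nonempty.2 zero_le_one) (continuous_infDist_pt C).continuousOn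
  rw [mem_sphere_zero_iff_norm] at hy₁
  set d := infDist y₁ C
  have hd0 : 0 ≤ d := infDist_nonneg
  have hd1 : d < 1 := by
    obtain ⟨z, hz, hzy⟩ := hexpr y₁ (by rintro rfl; simp at hy₁)
    rw [hy₁, ← dist_eq_norm, dist_comm] at hzy
    exact (infDist_le_dist_of_mem hz).trans_lt hzy
  have hopen : IsOpen {x : Y | ‖x‖ ^ 2 < 1 - d ^ 2} := isOpen_lt (by fun_prop) (by fun_prop)
  refine mem_interior.2 ⟨_, fun x hx => ?_, hopen, by simpa [abs_of_nonneg hd0] using hd1⟩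
  by_contra hxB
  obtain ⟨f, r, hfr, hrx⟩ := geometric_hahn_banach_closed_point
    (convex_convexHull ℝ _).closure isClosed_closure hxB
  set y := (InnerProductSpace.toDual ℝ Y).symm f
  have hyf : ∀ w, ⟪y, w⟫_ℝ = f w := fun w => InnerProductSpace.toDual_symm_apply
  have hlt : ∀ a ∈ C, ‖a‖ = 1 → ⟪y, a⟫_ℝ < ⟪y, x⟫_ℝ := fun a ha ha1 => by
    rw [hyf, hyf]
    exact (hfr a (subset_closure (subset_convexHull ℝ _ ⟨ha, by simpa using ha1⟩))).trans hrx
  have hnear : ∀ e : Y, ‖e‖ = 1 → ∃ z ∈ C, z ≠ 0 ∧ ‖z‖ ^ 2 + 1 - d ^ 2 ≤ 2 * ⟪e, z⟫_ℝ := by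
    intro e he
    obtain ⟨z, hz, hez⟩ := hC.exists_infDist_eq_dist hne e
    have hzd : ‖z - e‖ ≤ d := by
      rw [← dist_eq_norm, dist_comm, ← hez]
      exact hmax (by simpa using he)
    refine ⟨z, hz, ?_, ?_⟩
    · rintro rfl
      simp only [zero_sub, norm_neg, he] at hzd
      linarith
    · have h1 := norm_sub_sq_real z e
      rw [real_inner_comm, he] at h1
      nlinarith [norm_nonneg (z - e)]
  have hy0 : y ≠ 0 := by
    intro h0
    obtain ⟨z, hz, hz0, -⟩ := hnear y₁ hy₁
    have := hlt _ (hsmul z hz ‖z‖⁻¹ (by positivity)) (norm_smul_inv_norm hz0)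
    simp [h0] at this
  have hyp : 0 < ‖y‖ := norm_pos_iff.2 hy0
  obtain ⟨z, hz, hz0, hzy⟩ := hnear (‖y‖⁻¹ • y) (norm_smul_inv_norm hy0)
  have hzp : 0 < ‖z‖ := norm_pos_iff.2 hz0
  have h1 := hlt _ (hsmul z hz ‖z‖⁻¹ (by positivity)) (norm_smul_inv_norm hz0)
  rw [inner_smul_right, inv_mul_lt_iff₀ hzp] at h1
  have h2 : ⟪y, z⟫_ℝ < ‖y‖ * (‖z‖ * ‖x‖) := by
    nlinarith [mul_le_mul_of_nonneg_left (real_inner_le_norm y x) hzp.le]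
  rw [inner_smul_left, conj_trivial] at hzy
  have h3 : ‖y‖⁻¹ * ⟪y, z⟫_ℝ < ‖z‖ * ‖x‖ := (inv_mul_lt_iff₀ hyp).2 h2
  have hx' : ‖x‖ ^ 2 < 1 - d ^ 2 := hx
  nlinarith [sq_nonneg (‖z‖ - ‖x‖)]

/-- A closed cone which has unique nearest points, and which approximates every nonzero vector
better than `0` does, is the whole space. -/
lemma eq_univ_of_nearest_unique {Y : Type*} [NormedAddCommGroup Y]
    [InnerProductSpace ℝ Y] [FiniteDimensional ℝ Y] [Nontrivial Y] {C : Set Y} (hC : IsClosed C)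
    (hsmul : ∀ z ∈ C, ∀ s : ℝ, 0 ≤ s → s • z ∈ C)
    (hexpr : ∀ y : Y, y ≠ 0 → ∃ z ∈ C, ‖z - y‖ < ‖y‖)
    (huniq : ∀ y : Y, {z | z ∈ C ∧ ‖z - y‖ = infDist y C}.Subsingleton) : C = Set.univ := by
  have hproper : ProperSpace Y := FiniteDimensional.proper_real Y
  have h0 := zero_mem_interior_closure_convexHull_inter_sphere hC hsmul hexpr
  have hA : IsCompact (C ∩ sphere 0 1) := (isCompact_sphere 0 1).inter_left hC
  set A := C ∩ sphere (0 : Y) 1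
  set B := closure (convexHull ℝ A) with hB
  have hBconv : Convex ℝ B := (convex_convexHull ℝ A).closure
  have hBball : B ⊆ closedBall 0 1 := closure_minimal
    (convexHull_min (Set.inter_subset_right.trans sphere_subset_closedBall)
      (convex_closedBall 0 1)) isClosed_closedBall
  have hAne : A.Nonempty := by
    rw [Set.nonempty_iff_ne_empty]
    intro he
    simp [hB, he] at h0
  have hunit : ∀ u : Y, ‖u‖ = 1 → u ∈ C := by
    intro u hu
    have hT : IsCompact {t : ℝ | t ∈ Set.Icc (0 : ℝ) 1 ∧ t • u ∈ B} :=
      isCompact_Icc.inter_right (isClosed_closure.preimage (by fun_prop))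
    obtain ⟨t, ⟨⟨ht0, ht1⟩, htB⟩, htmax⟩ := hT.exists_isMaxOn
      ⟨0, ⟨le_rfl, zero_le_one⟩, by simpa using interior_subset h0⟩ continuousOn_id
    have hnot : t • u ∉ interior B := by
      intro hin
      have hnhds : ∀ᶠ s : ℝ in nhds t, s • u ∈ B := by
        have hc : Continuous fun s : ℝ => s • u := by fun_prop
        exact hc.continuousAt.eventually (mem_interior_iff_mem_nhds.1 hin)
      obtain ⟨ε, hε, hball⟩ := Metric.eventually_nhds_iff.1 hnhds
      have hs : (t + ε / 2) • u ∈ B := hball (by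
        rw [Real.dist_eq, add_sub_cancel_left, abs_of_pos (by positivity)]; linarith)
      have hs1 : t + ε / 2 ≤ 1 := by
        have := hBball hs
        rwa [mem_closedBall_zero_iff, norm_smul, hu, mul_one,
          Real.norm_of_nonneg (by positivity)] at this
      have : t + ε / 2 ≤ t := htmax ⟨⟨by positivity, hs1⟩, hs⟩
      linarith
    obtain ⟨f, hf⟩ := geometric_hahn_banach_open_point hBconv.interior isOpen_interior hnot
    have hfB : ∀ b ∈ B, f b ≤ f (t • u) := by
      have hsub : closure (interior B) ⊆ {b | f b ≤ f (t • u)} :=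
        closure_minimal (fun b hb => (hf b hb).le) (isClosed_le (by fun_prop) (by fun_prop))
      rw [hBconv.closure_interior_eq_closure_of_nonempty_interior ⟨0, h0⟩] at hsub
      exact fun b hb => hsub (subset_closure hb)
    have hfpos : 0 < f (t • u) := by simpa using hf 0 h0
    obtain ⟨a, ha, hamax⟩ := hA.exists_isMaxOn hAne f.continuous.continuousOn
    have hBa : B ⊆ {w | f w ≤ f a} := closure_minimal
      (convexHull_min hamax (convex_halfSpace_le f.toLinearMap.isLinear _))
      (isClosed_le (by fun_prop) (by fun_prop))
    have hfa : f (t • u) ≤ f a := hBa htB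
    set y := (InnerProductSpace.toDual ℝ Y).symm f
    have hyf : ∀ w, ⟪y, w⟫_ℝ = f w := fun w => InnerProductSpace.toDual_symm_apply
    have hstrict : ∀ b ∈ A, b ≠ a → f b < f a := by
      intro b hb hba
      refine lt_of_le_of_ne (hamax hb) fun hfe => hba ?_
      refine (eq_of_isMaxOn_inner_of_nearest_unique hsmul (huniq y) ha.1 (by simpa using ha.2)
        hb.1 (by simpa using hb.2) (by rw [hyf]; linarith) (fun c hc hc1 => ?_)
        (by rw [hyf, hyf, hfe])).symm
      rw [hyf, hyf]
      exact hamax ⟨hc, by simpa using hc1⟩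
    have hta : t • u = a := eq_of_mem_closure_convexHull_of_forall_lt hA f hstrict htB
      (hfB a (subset_closure (subset_convexHull ℝ A ha)))
    have ht : t = 1 := by
      have : ‖t • u‖ = 1 := by rw [hta]; simpa using ha.2
      rwa [norm_smul, hu, mul_one, Real.norm_of_nonneg ht0] at this
    rw [ht, one_smul] at hta
    exact hta ▸ ha.1
  refine Set.eq_univ_of_forall fun w => ?_
  rcases eq_or_ne w 0 with rfl | hw
  · obtain ⟨a, ha⟩ := hAne
    simpa using hsmul a ha.1 0 le_rfl
  · have := hsmul _ (hunit (‖w‖⁻¹ • w) (norm_smul_inv_norm hw)) ‖w‖ (norm_nonneg w)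
    rwa [smul_inv_smul₀ (norm_ne_zero_iff.2 hw)] at this

/-- The part of `S` close to `y` is contained in two disjoint closed sets, the first of which comes
strictly closer to `y` than the second, while the rest of `S` is uniformly further away from `y`. -/
def SplitsSublevel {Y : Type*} [NormedAddCommGroup Y] (S : Set Y) (y : Y) : Prop :=
  ∃ (T₁ T₂ : Set Y) (b c : ℝ), IsClosed T₁ ∧ IsClosed T₂ ∧ Disjoint T₁ T₂ ∧
    (∃ z ∈ S ∩ T₁, ‖z - y‖ < b) ∧ (S ∩ T₂).Nonempty ∧ (∀ z ∈ S ∩ T₂, b ≤ ‖z - y‖) ∧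
    (∀ z ∈ T₁ ∪ T₂, ‖z - y‖ ≤ c) ∧ ∀ z ∈ S, z ∉ T₁ ∪ T₂ → c < ‖z - y‖

lemma SplitsSublevel.smul {Y : Type*} [NormedAddCommGroup Y] [NormedSpace ℝ Y] {S : Set Y}
    (hcone : ∀ y ∈ S, ∀ s : ℝ, 0 < s → s • y ∈ S) {y : Y} (h : SplitsSublevel S y) {s : ℝ}
    (hs : 0 < s) : SplitsSublevel S (s • y) := by
  obtain ⟨T₁, T₂, b, c, h₁, h₂, hdisj, ⟨z₁, hz₁, hz₁b⟩, ⟨z₂, hz₂⟩, hb, hc, hout⟩ := h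
  have hcont : Continuous fun w : Y => s⁻¹ • w := by fun_prop
  have hnorm : ∀ w : Y, ‖w - s • y‖ = s * ‖s⁻¹ • w - y‖ := fun w => by
    conv_lhs => rw [← smul_inv_smul₀ hs.ne' w]
    rw [← smul_sub, norm_smul, Real.norm_of_nonneg hs.le]
  have hS : ∀ w ∈ S, s⁻¹ • w ∈ S := fun w hw => hcone w hw _ (inv_pos.2 hs)
  refine ⟨(fun w => s⁻¹ • w) ⁻¹' T₁, (fun w => s⁻¹ • w) ⁻¹' T₂, s * b, s * c,
    h₁.preimage hcont, h₂.preimage hcont, hdisj.preimage _,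
    ⟨s • z₁, ⟨hcone _ hz₁.1 s hs, ?_⟩, ?_⟩, ⟨s • z₂, hcone _ hz₂.1 s hs, ?_⟩, ?_, ?_, ?_⟩
  · simpa [inv_smul_smul₀ hs.ne'] using hz₁.2
  · rw [hnorm, inv_smul_smul₀ hs.ne']
    exact mul_lt_mul_of_pos_left hz₁b hs
  · simpa [inv_smul_smul₀ hs.ne'] using hz₂.2
  · intro w hw
    rw [hnorm]
    exact mul_le_mul_of_nonneg_left (hb _ ⟨hS w hw.1, hw.2⟩) hs.le
  · intro w hw
    rw [hnorm]
    exact mul_le_mul_of_nonneg_left (hc _ hw) hs.le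
  · intro w hwS hw
    rw [hnorm]
    exact mul_lt_mul_of_pos_left (hout _ (hS w hwS) hw) hs

/-- Moving `y` towards one of its nearest points `p` makes `p` strictly nearer than every other
point that is at least as far from `y`. -/
lemma norm_sub_lineMap_lt {Y : Type*} [NormedAddCommGroup Y] [InnerProductSpace ℝ Y]
    {y p w : Y} (hwp : w ≠ p) (hle : ‖p - y‖ ≤ ‖w - y‖) {τ : ℝ} (hτ : 0 < τ) (hτ1 : τ < 1) :
    ‖p - (y + τ • (p - y))‖ < ‖w - (y + τ • (p - y))‖ := by
  have hq : 0 < ‖w - p‖ ^ 2 := by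
    have := norm_pos_iff.2 (sub_ne_zero.2 hwp)
    positivity
  have h1 : ‖w - y‖ ^ 2 = ‖w - p‖ ^ 2 + 2 * ⟪w - p, p - y⟫_ℝ + ‖p - y‖ ^ 2 := by
    rw [← norm_add_sq_real, sub_add_sub_cancel]
  have h2 : ‖p - (y + τ • (p - y))‖ ^ 2 = (1 - τ) ^ 2 * ‖p - y‖ ^ 2 := by
    have : p - (y + τ • (p - y)) = (1 - τ) • (p - y) := by module
    rw [this, norm_smul, mul_pow, Real.norm_eq_abs, sq_abs]
  have h3 : ‖w - (y + τ • (p - y))‖ ^ 2 =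
      ‖w - p‖ ^ 2 + 2 * ((1 - τ) * ⟪w - p, p - y⟫_ℝ) + (1 - τ) ^ 2 * ‖p - y‖ ^ 2 := by
    have : w - (y + τ • (p - y)) = (w - p) + (1 - τ) • (p - y) := by module
    rw [this, norm_add_sq_real, norm_smul, mul_pow, Real.norm_eq_abs, sq_abs, inner_smul_right]
  have h4 : ‖p - y‖ ^ 2 ≤ ‖w - y‖ ^ 2 := pow_le_pow_left₀ (norm_nonneg _) hle 2
  refine lt_of_pow_lt_pow_left₀ 2 (norm_nonneg _) ?_
  rw [h2, h3]
  nlinarith [mul_nonneg (sub_nonneg.2 hτ1.le) (sub_nonneg.2 h4)]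

/-- If `p` is an isolated but not the only nearest point of `y` in `closure S`, then
`SplitsSublevel S` holds on a nonempty open set. -/
lemma interior_splitsSublevel_nonempty {Y : Type*} [NormedAddCommGroup Y]
    [InnerProductSpace ℝ Y] [FiniteDimensional ℝ Y] {S : Set Y} {y p q : Y} {ε : ℝ} (hε : 0 < ε)
    (hp : p ∈ closure S) (hpy : ‖p - y‖ = infDist y (closure S))
    (hq : q ∈ closure S) (hqy : ‖q - y‖ = infDist y (closure S)) (hqp : 2 * ε < ‖q - p‖)
    (hiso : ∀ z ∈ closure S, ‖z - y‖ = infDist y (closure S) → ε ≤ ‖z - p‖ → 2 * ε < ‖z - p‖) :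
    (interior {y | SplitsSublevel S y}).Nonempty := by
  have hproper : ProperSpace Y := FiniteDimensional.proper_real Y
  set d := infDist y (closure S)
  have hd0 : 0 ≤ d := infDist_nonneg
  have hle : ∀ z ∈ closure S, d ≤ ‖z - y‖ := fun z hz => by
    rw [← dist_eq_norm, dist_comm]
    exact infDist_le_dist_of_mem hz
  obtain ⟨δ, hδ, hgap⟩ : ∃ δ > 0, ∀ z ∈ closure S, ε ≤ ‖z - p‖ → ‖z - p‖ ≤ 2 * ε →
      d + 2 * δ ≤ ‖z - y‖ := by
    have hN : IsCompact ((closure S ∩ {z | ε ≤ ‖z - p‖}) ∩ closedBall p (2 * ε)) :=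
      (isCompact_closedBall _ _).inter_left
        (isClosed_closure.inter (isClosed_le (by fun_prop) (by fun_prop)))
    rcases Set.eq_empty_or_nonempty
      ((closure S ∩ {z | ε ≤ ‖z - p‖}) ∩ closedBall p (2 * ε)) with he | hne
    · refine ⟨1, one_pos, fun z hz h1 h2 => ?_⟩
      have : z ∈ ((closure S ∩ {z | ε ≤ ‖z - p‖}) ∩ closedBall p (2 * ε)) :=
        ⟨⟨hz, h1⟩, by rwa [mem_closedBall, dist_eq_norm]⟩
      simp [he] at this
    · obtain ⟨w, ⟨⟨hw, hw1⟩, hw2⟩, hmin⟩ := hN.exists_isMinOn hne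
        (f := fun z => ‖z - y‖) (by fun_prop)
      rw [mem_closedBall, dist_eq_norm] at hw2
      have hdw : d < ‖w - y‖ :=
        lt_of_le_of_ne (hle w hw) fun h => (hiso w hw h.symm hw1).not_ge hw2
      refine ⟨(‖w - y‖ - d) / 2, by linarith, fun z hz h1 h2 => ?_⟩
      have : ‖w - y‖ ≤ ‖z - y‖ := hmin ⟨⟨hz, h1⟩, by rwa [mem_closedBall, dist_eq_norm]⟩
      linarith
  set far := closure S ∩ {z | 2 * ε ≤ ‖z - p‖}
  have hfarc : IsClosed far := isClosed_closure.inter (isClosed_le (by fun_prop) (by fun_prop))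
  have hfarne : far.Nonempty := ⟨q, hq, hqp.le⟩
  set U := {y' : Y | ‖y' - y‖ < δ} ∩ {y' | ‖p - y'‖ < infDist y' far}
  have hUo : IsOpen U := (isOpen_lt (by fun_prop) (by fun_prop)).inter
    (isOpen_lt (by fun_prop) (continuous_infDist_pt far))
  have hUne : U.Nonempty := by
    have hden : 0 < d + 1 + δ := by positivity
    have hτ : 0 < δ / (d + 1 + δ) := by positivity
    refine ⟨y + (δ / (d + 1 + δ)) • (p - y), ?_, ?_⟩
    · simp only [Set.mem_ofPred_eq, add_sub_cancel_left]
      rw [norm_smul, hpy, Real.norm_of_nonneg hτ.le, div_mul_eq_mul_div, div_lt_iff₀ hden]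
      nlinarith
    · obtain ⟨w, hw, hwd⟩ := hfarc.exists_infDist_eq_dist hfarne
        (y + (δ / (d + 1 + δ)) • (p - y))
      rw [Set.mem_ofPred_eq, hwd, dist_comm, dist_eq_norm w]
      refine norm_sub_lineMap_lt ?_ (hpy.trans_le (hle w hw.1)) hτ
        ((div_lt_one hden).2 (by linarith))
      rintro rfl
      have := hw.2
      simp only [Set.mem_ofPred_eq, sub_self, norm_zero] at this
      linarith
  refine hUne.mono (interior_maximal (fun y' hy' => ?_) hUo)
  obtain ⟨hy'δ : ‖y' - y‖ < δ, hy'far : ‖p - y'‖ < infDist y' far⟩ := hy'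
  have hclose : ∀ z : Y, ‖z - y'‖ ≤ ‖z - y‖ + ‖y' - y‖ := fun z => by
    rw [norm_sub_rev y' y]; exact norm_sub_le_norm_sub_add_norm_sub z y y'
  have hclose' : ∀ z : Y, ‖z - y‖ ≤ ‖z - y'‖ + ‖y' - y‖ := fun z =>
    norm_sub_le_norm_sub_add_norm_sub z y' y
  refine ⟨closedBall p ε ∩ closedBall y' (d + δ), {z | 2 * ε ≤ ‖z - p‖} ∩ closedBall y' (d + δ),
    infDist y' far, d + δ, isClosed_closedBall.inter isClosed_closedBall,
    (isClosed_le (by fun_prop) (by fun_prop)).inter isClosed_closedBall, ?_, ?_, ?_, ?_, ?_, ?_⟩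
  · rw [Set.disjoint_left]
    rintro z ⟨h1, -⟩ ⟨h2, -⟩
    rw [mem_closedBall, dist_eq_norm] at h1
    simp only [Set.mem_ofPred_eq] at h2
    linarith
  · have hVo : IsOpen ({z : Y | ‖z - p‖ < ε} ∩ {z | ‖z - y'‖ < d + δ} ∩
        {z | ‖z - y'‖ < infDist y' far}) :=
      ((isOpen_lt (by fun_prop) (by fun_prop)).inter
        (isOpen_lt (by fun_prop) (by fun_prop))).inter (isOpen_lt (by fun_prop) (by fun_prop))
    obtain ⟨z, ⟨⟨h1, h2⟩, h3⟩, hzS⟩ := mem_closure_iff.1 hp _ hVo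
      ⟨⟨by simpa using hε, by have := hclose p; simp only [Set.mem_ofPred_eq]; linarith⟩, hy'far⟩
    simp only [Set.mem_ofPred_eq] at h1 h2 h3
    exact ⟨z, ⟨hzS, by rw [mem_closedBall, dist_eq_norm]; exact h1.le,
      by rw [mem_closedBall, dist_eq_norm]; exact h2.le⟩, h3⟩
  · have hVo : IsOpen ({z : Y | 2 * ε < ‖z - p‖} ∩ {z | ‖z - y'‖ < d + δ}) :=
      (isOpen_lt (by fun_prop) (by fun_prop)).inter (isOpen_lt (by fun_prop) (by fun_prop))
    obtain ⟨z, ⟨h1, h2⟩, hzS⟩ := mem_closure_iff.1 hq _ hVo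
      ⟨hqp, by have := hclose q; simp only [Set.mem_ofPred_eq]; linarith⟩
    simp only [Set.mem_ofPred_eq] at h1 h2
    exact ⟨z, hzS, h1.le, by rw [mem_closedBall, dist_eq_norm]; exact h2.le⟩
  · rintro z ⟨hzS, hz, -⟩
    rw [← dist_eq_norm, dist_comm]
    exact infDist_le_dist_of_mem ⟨subset_closure hzS, hz⟩
  · rintro z (⟨-, hz⟩ | ⟨-, hz⟩) <;> rwa [mem_closedBall, dist_eq_norm] at hz
  · intro z hzS hz
    by_contra! hzd
    have hzball : z ∈ closedBall y' (d + δ) := by rwa [mem_closedBall, dist_eq_norm]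
    have h1 : ε < ‖z - p‖ := by
      by_contra! h
      exact hz (Or.inl ⟨by rwa [mem_closedBall, dist_eq_norm], hzball⟩)
    have h2 : ‖z - p‖ < 2 * ε := by
      by_contra! h
      exact hz (Or.inr ⟨h, hzball⟩)
    have := hgap z (subset_closure hzS) h1.le h2.le
    have := hclose' z
    linarith

/-- A finite set of nearest points with at least two elements has an isolated one. -/
lemma interior_splitsSublevel_nonempty_of_finite {Y : Type*} [NormedAddCommGroup Y]
    [InnerProductSpace ℝ Y] [FiniteDimensional ℝ Y] {S : Set Y} {y : Y}
    (hfin : {z | z ∈ closure S ∧ ‖z - y‖ = infDist y (closure S)}.Finite)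
    (hnt : {z | z ∈ closure S ∧ ‖z - y‖ = infDist y (closure S)}.Nontrivial) :
    (interior {y | SplitsSublevel S y}).Nonempty := by
  obtain ⟨p, hp, q, hq, hpq⟩ := hnt
  set P := {z | z ∈ closure S ∧ ‖z - y‖ = infDist y (closure S)}
  obtain ⟨w, hw, hmin⟩ := Set.exists_min_image (P \ {p}) (fun z => ‖z - p‖) hfin.sdiff
    ⟨q, hq, hpq.symm⟩
  have hwp : 0 < ‖w - p‖ := norm_pos_iff.2 (sub_ne_zero.2 hw.2)
  have hlt : ∀ z ∈ P, z ≠ p → 2 * (‖w - p‖ / 3) < ‖z - p‖ := fun z hz hzp => by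
    have := hmin z ⟨hz, hzp⟩
    linarith
  refine interior_splitsSublevel_nonempty (ε := ‖w - p‖ / 3) (by positivity) hp.1 hp.2 hq.1 hq.2
    (hlt q hq hpq.symm) fun z hz hzy hε => hlt z ⟨hz, hzy⟩ ?_
  rintro rfl
  rw [sub_self, norm_zero] at hε
  linarith

/-- Pulling back a splitting of the image of `F` gives a splitting of the parameter set. -/
lemma SplitsSublevel.exists_parameter_sets {X Y : Type*} [TopologicalSpace X]
    [NormedAddCommGroup Y] {D : Set X} {F : X → Y} (hcont : ContinuousOn F D) {y : Y}
    (h : SplitsSublevel (F '' D) y) :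
    ∃ Di : Fin 2 → Set X, (∀ i, (Di i).Nonempty) ∧ Pairwise (Function.onFun Disjoint Di) ∧
      (∀ i, ∃ T : Set X, IsClosed T ∧ Di i = T ∩ D) ∧
      (∀ i : Fin 2, i ≠ 0 → sInf ((fun α => ‖F α - y‖ ^ 2) '' Di 0) <
        sInf ((fun α => ‖F α - y‖ ^ 2) '' Di i)) ∧
      ∀ αt ∈ D \ ⋃ i, Di i,
        sSup ((fun α => ‖F α - y‖ ^ 2) '' ⋃ i, Di i) < ‖F αt - y‖ ^ 2 := by
  obtain ⟨T₁, T₂, b, c, h₁, h₂, hdisj, ⟨_, ⟨⟨α₁, hα₁, rfl⟩, hα₁T⟩, hα₁b⟩,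
    ⟨_, ⟨α₂, hα₂, rfl⟩, hα₂T⟩, hb, hc, hout⟩ := h
  have hb0 : 0 ≤ b := (norm_nonneg _).trans hα₁b.le
  have hrel : ∀ T : Set Y, IsClosed T → ∃ T' : Set X, IsClosed T' ∧ D ∩ F ⁻¹' T = T' ∩ D :=
    fun T hT => by
      obtain ⟨T', hT', he⟩ := continuousOn_iff_isClosed.1 hcont T hT
      exact ⟨T', hT', by rw [Set.inter_comm, he]⟩
  have hdisj' : Disjoint (D ∩ F ⁻¹' T₁) (D ∩ F ⁻¹' T₂) :=
    (hdisj.preimage F).mono Set.inter_subset_right Set.inter_subset_right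
  have hUnion : (⋃ i, (![D ∩ F ⁻¹' T₁, D ∩ F ⁻¹' T₂] : Fin 2 → Set X) i) =
      D ∩ F ⁻¹' (T₁ ∪ T₂) := by
    ext α
    simp only [Set.mem_iUnion, Fin.exists_fin_two, Matrix.cons_val_zero, Matrix.cons_val_one,
      Set.mem_inter_iff, Set.mem_preimage, Set.mem_union]
    tauto
  refine ⟨![D ∩ F ⁻¹' T₁, D ∩ F ⁻¹' T₂], ?_, ?_, ?_, ?_, ?_⟩
  · exact Fin.forall_fin_two.2 ⟨⟨α₁, hα₁, hα₁T⟩, ⟨α₂, hα₂, hα₂T⟩⟩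
  · intro i j hij
    fin_cases i <;> fin_cases j
    · exact absurd rfl hij
    · exact hdisj'
    · exact hdisj'.symm
    · exact absurd rfl hij
  · exact Fin.forall_fin_two.2 ⟨hrel T₁ h₁, hrel T₂ h₂⟩
  · refine Fin.forall_fin_two.2 ⟨fun h => absurd rfl h, fun _ => ?_⟩
    calc sInf ((fun α => ‖F α - y‖ ^ 2) '' (D ∩ F ⁻¹' T₁))
        ≤ ‖F α₁ - y‖ ^ 2 := csInf_le ⟨0, by rintro _ ⟨α, -, rfl⟩; positivity⟩
          ⟨α₁, ⟨hα₁, hα₁T⟩, rfl⟩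
      _ < b ^ 2 := pow_lt_pow_left₀ hα₁b (norm_nonneg _) two_ne_zero
      _ ≤ sInf ((fun α => ‖F α - y‖ ^ 2) '' (D ∩ F ⁻¹' T₂)) := by
          refine le_csInf ⟨_, α₂, ⟨hα₂, hα₂T⟩, rfl⟩ ?_
          rintro _ ⟨α, ⟨hα, hαT⟩, rfl⟩
          exact pow_le_pow_left₀ hb0 (hb _ ⟨⟨α, hα, rfl⟩, hαT⟩) 2
  · rw [hUnion]
    rintro α ⟨hα, hαT⟩
    have hc0 : 0 ≤ c := (norm_nonneg _).trans (hc _ (Or.inl hα₁T))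
    calc sSup ((fun α => ‖F α - y‖ ^ 2) '' (D ∩ F ⁻¹' (T₁ ∪ T₂))) ≤ c ^ 2 := by
          refine csSup_le ⟨_, α₁, ⟨hα₁, Or.inl hα₁T⟩, rfl⟩ ?_
          rintro _ ⟨α', ⟨-, hα'⟩, rfl⟩
          exact pow_le_pow_left₀ (norm_nonneg _) (hc _ hα') 2
      _ < ‖F α - y‖ ^ 2 :=
          pow_lt_pow_left₀ (hout _ ⟨α, hα, rfl⟩ fun h => hαT ⟨hα, h⟩) hc0 two_ne_zero

/-- The closure of a nonempty cone is closed under multiplication by nonnegative scalars. -/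
lemma smul_mem_closure_of_nonneg {Y : Type*} [NormedAddCommGroup Y] [NormedSpace ℝ Y] {S : Set Y}
    (hcone : ∀ y ∈ S, ∀ s : ℝ, 0 < s → s • y ∈ S) {z : Y} (hz : z ∈ closure S) {s : ℝ}
    (hs : 0 ≤ s) : s • z ∈ closure S := by
  have hpos : ∀ r ∈ Set.Ioi (0 : ℝ), r • z ∈ closure S := fun r hr =>
    map_mem_closure (continuous_const_smul r) hz fun y hy => hcone y hy r hr
  have hcont : Continuous fun r : ℝ => r • z := by fun_prop
  have := map_mem_closure hcont (s := Set.Ioi (0 : ℝ)) (by rw [closure_Ioi]; exact hs) hpos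
  rwa [closure_closure] at this

theorem setvalued_or_spurious {Y : Type} [NormedAddCommGroup Y]
    [InnerProductSpace ℝ Y] [FiniteDimensional ℝ Y] [Nontrivial Y] {m : ℕ}
    (D : Set (Fin m → ℝ)) (hD : D.Nonempty) (F : (Fin m → ℝ) → Y)
    (hcone : ∀ y ∈ F '' D, ∀ s : ℝ, 0 < s → s • y ∈ F '' D)
    (hexpr : ∀ y : Y, y ≠ 0 → lossInf D F y < ‖y‖ ^ 2)
    (hcl : closure (F '' D) ≠ Set.univ)
    (hcont : ContinuousOn F D)
    (hcard : Set.range (fun y : Y => (bestApprox D F y).encard) ≠ ({1, ⊤} : Set ℕ∞)) :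
    ∃ K : Set Y, IsOpen K ∧ K.Nonempty ∧ (∀ y ∈ K, ∀ s : ℝ, 0 < s → s • y ∈ K) ∧
      ∃ M : ℕ, ∃ hM : 2 ≤ M,
        ∀ yd ∈ K, ∃ Di : Fin M → Set (Fin m → ℝ),
          (∀ i, (Di i).Nonempty) ∧
          (Pairwise (Function.onFun Disjoint Di)) ∧
          (∀ i, ∃ T : Set (Fin m → ℝ), IsClosed T ∧ Di i = T ∩ D) ∧
          (∀ i : Fin M, i ≠ ⟨0, by omega⟩ →
            sInf ((fun α => ‖F α - yd‖ ^ 2) '' Di ⟨0, by omega⟩) <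
              sInf ((fun α => ‖F α - yd‖ ^ 2) '' Di i)) ∧
          (∀ αt ∈ D \ ⋃ i, Di i,
            sSup ((fun α => ‖F α - yd‖ ^ 2) '' ⋃ i, Di i) < ‖F αt - yd‖ ^ 2) := by
  by_cases hex : ∃ y : Y, (bestApprox D F y).Finite ∧ (bestApprox D F y).Nontrivial
  · obtain ⟨y, hfin, hnt⟩ := hex
    have hsplit : ∀ w ∈ interior {y | SplitsSublevel (F '' D) y}, SplitsSublevel (F '' D) w :=
      fun w hw => interior_subset (s := {y | SplitsSublevel (F '' D) y}) hw
    refine ⟨interior {y | SplitsSublevel (F '' D) y}, isOpen_interior,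
      interior_splitsSublevel_nonempty_of_finite hfin hnt, fun y hy s hs => ?_, 2, le_rfl,
      fun yd hyd => (hsplit yd hyd).exists_parameter_sets hcont⟩
    have hpre : (fun w : Y => s⁻¹ • w) ⁻¹' interior {y | SplitsSublevel (F '' D) y} ⊆
        {y | SplitsSublevel (F '' D) y} := fun w hw => by
      have := (hsplit _ hw).smul hcone hs
      rwa [smul_inv_smul₀ hs.ne'] at this
    refine interior_maximal hpre (isOpen_interior.preimage (continuous_const_smul s⁻¹)) ?_
    rwa [Set.mem_preimage, inv_smul_smul₀ hs.ne']
  · exfalso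
    have hsmul : ∀ z ∈ closure (F '' D), ∀ s : ℝ, 0 ≤ s → s • z ∈ closure (F '' D) :=
      fun z hz s hs => smul_mem_closure_of_nonneg hcone hz hs
    have hne : (closure (F '' D)).Nonempty := (hD.image F).closure
    have happ : ∀ y : Y, (bestApprox D F y).Nonempty := fun y => by
      obtain ⟨z, hz, hzy⟩ := isClosed_closure.exists_infDist_eq_dist hne y
      exact ⟨z, hz, by rw [hzy, dist_comm, dist_eq_norm]⟩
    have hone : ∀ y : Y, (bestApprox D F y).Subsingleton → (bestApprox D F y).encard = 1 :=
      fun y hy => Set.encard_eq_one.2 (Set.exists_eq_singleton_iff_nonempty_subsingleton.2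
        ⟨happ y, hy⟩)
    have hzero : (0 : Y) ∈ closure (F '' D) := by
      obtain ⟨z, hz⟩ := hne
      simpa using hsmul z hz 0 le_rfl
    have hone0 : (bestApprox D F 0).encard = 1 := hone 0 fun z hz w hw => by
      have h0 : ∀ z ∈ bestApprox D F 0, z = 0 := fun z hz => by
        have := hz.2
        rwa [infDist_zero_of_mem hzero, sub_zero, norm_eq_zero] at this
      rw [h0 z hz, h0 w hw]
    have hfinite : ∀ y : Y, (bestApprox D F y).encard ≠ ⊤ := by
      intro y₁ hy₁
      refine hcard (Set.Subset.antisymm ?_ ?_)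
      · rintro _ ⟨y, rfl⟩
        by_cases hy : (bestApprox D F y).Finite
        · exact Or.inl (hone y (Set.not_nontrivial_iff.1 fun h => hex ⟨y, hy, h⟩))
        · exact Or.inr (Set.encard_eq_top_iff.2 hy)
      · rintro _ (rfl | rfl)
        exacts [⟨0, hone0⟩, ⟨y₁, hy₁⟩]
    refine hcl (eq_univ_of_nearest_unique isClosed_closure hsmul (fun y hy => ?_) fun y =>
      Set.not_nontrivial_iff.1 fun h => hex ⟨y, Set.encard_ne_top_iff.1 (hfinite y), h⟩)
    obtain ⟨_, ⟨α, hα, rfl⟩, hlt⟩ := exists_lt_of_csInf_lt (hD.image _) (hexpr y hy)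
    exact ⟨F α, subset_closure ⟨α, hα, rfl⟩, lt_of_pow_lt_pow_left₀ 2 (norm_nonneg y) hlt⟩
end
end

section
/- All orthogonal perturbation directions lead to suboptimality: let ᾱ ∈ D, let v ∈ Y satisfy ‖v‖ = 1 and ⟨v, F(ᾱ)⟩ = 0, and set y^s := F(ᾱ) + s·v for s ∈ ℝ. Then for every s ∈ ℝ with |s| > (Θ/(1 − Θ))^{1/2}·‖F(ᾱ)‖ one has inf_{α ∈ D} L_{y^s}(α) < L_{y^s}(ᾱ); in particular, ᾱ is not a global minimizer of L_{y^s} for any such s. -/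
open Filter Metric
open scoped InnerProductSpace

noncomputable section

section LossInf

variable {Y : Type} [NormedAddCommGroup Y] {m : ℕ} {D : Set (Fin m → ℝ)} {F : (Fin m → ℝ) → Y}

lemma bddBelow_loss_image (y : Y) : BddBelow ((fun α => ‖F α - y‖ ^ 2) '' D) := by
  refine ⟨0, ?_⟩
  rintro _ ⟨α, -, rfl⟩
  positivity

lemma lossInf_le {α : Fin m → ℝ} (hα : α ∈ D) (y : Y) : lossInf D F y ≤ ‖F α - y‖ ^ 2 :=
  csInf_le (bddBelow_loss_image y) ⟨α, hα, rfl⟩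

lemma lossInf_nonneg (y : Y) : 0 ≤ lossInf D F y := by
  apply Real.sInf_nonneg
  rintro _ ⟨α, -, rfl⟩
  positivity

lemma upperSemicontinuous_lossInf : UpperSemicontinuous (lossInf D F) := by
  have h : lossInf D F = fun y => ⨅ α : D, ‖F α - y‖ ^ 2 := by
    funext y
    exact sInf_image'
  rw [h]
  refine upperSemicontinuous_ciInf (fun y => ?_) fun α => ?_
  · refine ⟨0, ?_⟩
    rintro _ ⟨α, rfl⟩
    positivity
  · exact Continuous.upperSemicontinuous (by fun_prop)

variable [InnerProductSpace ℝ Y]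

lemma lossInf_smul_le (hD : D.Nonempty)
    (hcone : ∀ y ∈ F '' D, ∀ s : ℝ, 0 < s → s • y ∈ F '' D) {t : ℝ} (ht : 0 < t) (y : Y) :
    lossInf D F (t • y) ≤ t ^ 2 * lossInf D F y := by
  rw [← div_le_iff₀' (by positivity)]
  refine le_csInf (hD.image _) ?_
  rintro _ ⟨α, hα, rfl⟩
  obtain ⟨β, hβ, hβα⟩ := hcone _ ⟨α, hα, rfl⟩ t ht
  rw [div_le_iff₀' (by positivity)]
  refine (lossInf_le hβ _).trans_eq ?_
  rw [hβα, ← smul_sub, norm_smul, mul_pow, Real.norm_eq_abs, sq_abs]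

variable [FiniteDimensional ℝ Y] [Nontrivial Y]

/-- The supremum defining `Theta` is attained. -/
lemma exists_isGreatest_lossInf_sphere :
    ∃ y : Y, ‖y‖ = 1 ∧ ∀ z : Y, ‖z‖ = 1 → lossInf D F z ≤ lossInf D F y := by
  have : ProperSpace Y := FiniteDimensional.proper ℝ Y
  obtain ⟨y, hy, hmax⟩ := (upperSemicontinuous_lossInf (D := D) (F := F)
    |>.upperSemicontinuousOn (sphere (0 : Y) 1)).exists_isMaxOn
    (NormedSpace.sphere_nonempty.2 zero_le_one) (isCompact_sphere (0 : Y) 1)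
  exact ⟨y, by simpa using hy, fun z hz => hmax (by simpa using hz)⟩

lemma lossInf_le_Theta {y : Y} (hy : ‖y‖ = 1) : lossInf D F y ≤ Theta D F := by
  obtain ⟨y₀, -, hmax⟩ := exists_isGreatest_lossInf_sphere (D := D) (F := F)
  refine le_csSup ⟨lossInf D F y₀, ?_⟩ ⟨y, hy, rfl⟩
  rintro _ ⟨z, hz, rfl⟩
  exact hmax z hz

lemma Theta_lt_one (hexpr : ∀ y : Y, y ≠ 0 → lossInf D F y < ‖y‖ ^ 2) : Theta D F < 1 := by
  obtain ⟨y₀, hy₀, hmax⟩ := exists_isGreatest_lossInf_sphere (D := D) (F := F)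
  have hlt := hexpr y₀ (norm_ne_zero_iff.1 (by simp [hy₀]))
  rw [hy₀, one_pow] at hlt
  refine lt_of_le_of_lt (csSup_le ⟨_, y₀, hy₀, rfl⟩ ?_) hlt
  rintro _ ⟨z, hz, rfl⟩
  exact hmax z hz

lemma lossInf_le_Theta_mul_norm_sq (hD : D.Nonempty)
    (hcone : ∀ y ∈ F '' D, ∀ s : ℝ, 0 < s → s • y ∈ F '' D) {y : Y} (hy : y ≠ 0) :
    lossInf D F y ≤ Theta D F * ‖y‖ ^ 2 := by
  have hpos : 0 < ‖y‖ := norm_pos_iff.2 hy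
  have hunit : ‖‖y‖⁻¹ • y‖ = 1 := by
    rw [norm_smul, norm_inv, norm_norm, inv_mul_cancel₀ hpos.ne']
  calc lossInf D F y = lossInf D F (‖y‖ • ‖y‖⁻¹ • y) := by rw [smul_inv_smul₀ hpos.ne']
    _ ≤ ‖y‖ ^ 2 * lossInf D F (‖y‖⁻¹ • y) := lossInf_smul_le hD hcone hpos _
    _ ≤ ‖y‖ ^ 2 * Theta D F := by gcongr; exact lossInf_le_Theta hunit
    _ = Theta D F * ‖y‖ ^ 2 := mul_comm _ _

end LossInf

theorem orthogonal_perturbation_suboptimality {Y : Type} [NormedAddCommGroup Y]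
    [InnerProductSpace ℝ Y] [FiniteDimensional ℝ Y] [Nontrivial Y] {m : ℕ}
    (D : Set (Fin m → ℝ)) (hD : D.Nonempty) (F : (Fin m → ℝ) → Y)
    (hcone : ∀ y ∈ F '' D, ∀ s : ℝ, 0 < s → s • y ∈ F '' D)
    (hexpr : ∀ y : Y, y ≠ 0 → lossInf D F y < ‖y‖ ^ 2)
    (abar : Fin m → ℝ) (habar : abar ∈ D)
    (v : Y) (hv1 : ‖v‖ = 1) (hvorth : ⟪v, F abar⟫_ℝ = 0) :
    ∀ s : ℝ, Real.sqrt (Theta D F / (1 - Theta D F)) * ‖F abar‖ < |s| →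
      lossInf D F (F abar + s • v) < ‖F abar - (F abar + s • v)‖ ^ 2 := by
  intro s hs
  have hT1 : 0 < 1 - Theta D F := sub_pos.2 (Theta_lt_one hexpr)
  have hT0 : 0 ≤ Theta D F := (lossInf_nonneg v).trans (lossInf_le_Theta hv1)
  have hspos : 0 < |s| := lt_of_le_of_lt (by positivity) hs
  have hsq : Theta D F / (1 - Theta D F) * ‖F abar‖ ^ 2 < s ^ 2 := by
    have h := pow_lt_pow_left₀ hs (by positivity) two_ne_zero
    rwa [mul_pow, Real.sq_sqrt (by positivity), sq_abs] at h
  rw [div_mul_eq_mul_div, div_lt_iff₀ hT1] at hsq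
  have hnorm : ‖F abar + s • v‖ ^ 2 = ‖F abar‖ ^ 2 + s ^ 2 := by
    rw [norm_add_sq_real, inner_smul_right, real_inner_comm, hvorth, norm_smul, hv1,
      Real.norm_eq_abs, mul_one, sq_abs]
    ring
  have hne : F abar + s • v ≠ 0 := by
    intro h
    rw [h, norm_zero] at hnorm
    nlinarith [sq_abs s, sq_nonneg ‖F abar‖]
  have hloss : ‖F abar - (F abar + s • v)‖ ^ 2 = s ^ 2 := by
    rw [sub_add_cancel_left, norm_neg, norm_smul, hv1, mul_one, Real.norm_eq_abs, sq_abs]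
  rw [hloss]
  refine (lossInf_le_Theta_mul_norm_sq hD hcone hne).trans_lt ?_
  rw [hnorm]
  linarith
end
end

section
/- Instability and nonuniqueness in the realizable case: suppose ᾱ ∈ D, there exist an open set U ⊆ ℝ^m with ᾱ ∈ U ⊆ D and a linear subspace V of Y with V ≠ Y such that F(U) ⊆ V, and suppose closure(S) = Y. Let v be an element of the orthogonal complement of V with ‖v‖ = 1, set ȳ := F(ᾱ) and y^s := ȳ + s·v for s ∈ ℝ \ {0}. Then: ᾱ is a global minimizer of L_{ȳ}; y^s → ȳ as s → 0; for every s ≠ 0 no element of U is a global minimizer of L_{y^s}; and there exists a family (α_s)_{s ∈ ℝ\{0}} of points of D \ U with lim_{s → 0} ‖F(α_s) − ȳ‖² = 0 = ‖F(ᾱ) − ȳ‖², so that L_{ȳ} possesses a minimizing sequence that does not converge to ᾱ. -/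
open Filter Metric
open scoped InnerProductSpace

noncomputable section

/-- Every point of `V` has distance at least `|s|` from `w + s • v` when `w ∈ V` and `v` is a unit
vector orthogonal to `V`. -/
theorem abs_le_norm_sub_add_smul_of_mem_orthogonal {Y : Type*} [NormedAddCommGroup Y]
    [InnerProductSpace ℝ Y] {V : Submodule ℝ Y} {u v w : Y} (hu : u ∈ V) (hw : w ∈ V)
    (hv : v ∈ Vᗮ) (hv1 : ‖v‖ = 1) (s : ℝ) : |s| ≤ ‖u - (w + s • v)‖ := by
  have huv : ⟪u, v⟫_ℝ = 0 := hv u hu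
  have hwv : ⟪w, v⟫_ℝ = 0 := hv w hw
  have hinner : ⟪u - (w + s • v), v⟫_ℝ = -s := by
    simp [inner_sub_left, inner_add_left, real_inner_smul_left, huv, hwv, hv1]
  simpa [hinner, hv1] using abs_real_inner_le_norm (u - (w + s • v)) v

theorem instability_realizable_case {Y : Type} [NormedAddCommGroup Y]
    [InnerProductSpace ℝ Y] [FiniteDimensional ℝ Y] [Nontrivial Y] {m : ℕ}
    (D : Set (Fin m → ℝ)) (hD : D.Nonempty) (F : (Fin m → ℝ) → Y)
    (hcone : ∀ y ∈ F '' D, ∀ s : ℝ, 0 < s → s • y ∈ F '' D)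
    (hexpr : ∀ y : Y, y ≠ 0 → lossInf D F y < ‖y‖ ^ 2)
    (abar : Fin m → ℝ) (habar : abar ∈ D)
    (U : Set (Fin m → ℝ)) (hU : IsOpen U) (haU : abar ∈ U) (hUD : U ⊆ D)
    (V : Submodule ℝ Y) (hV : V ≠ ⊤) (hFU : F '' U ⊆ V)
    (hcl : closure (F '' D) = Set.univ)
    (v : Y) (hv : v ∈ Vᗮ) (hv1 : ‖v‖ = 1) :
    IsMinOn (fun α => ‖F α - F abar‖ ^ 2) D abar ∧
    Filter.Tendsto (fun s : ℝ => F abar + s • v) (nhds 0) (nhds (F abar)) ∧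
    (∀ s : ℝ, s ≠ 0 → ∀ α ∈ U,
      ¬ IsMinOn (fun β => ‖F β - (F abar + s • v)‖ ^ 2) D α) ∧
    ∃ af : ℝ → (Fin m → ℝ),
      (∀ s : ℝ, s ≠ 0 → af s ∈ D \ U) ∧
      Filter.Tendsto (fun s => ‖F (af s) - F abar‖ ^ 2)
        (nhdsWithin 0 {0}ᶜ) (nhds 0) ∧
      ‖F abar - F abar‖ ^ 2 = 0 := by
  have hFV : ∀ α ∈ U, F α ∈ V := fun α hα => hFU ⟨α, hα, rfl⟩
  have hlower : ∀ s : ℝ, ∀ α ∈ U, |s| ≤ ‖F α - (F abar + s • v)‖ := fun s α hα =>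
    abs_le_norm_sub_add_smul_of_mem_orthogonal (hFV α hα) (hFV abar haU) hv hv1 s
  have hnear : ∀ s : ℝ, ∃ β, s ≠ 0 → β ∈ D ∧ ‖F β - (F abar + s • v)‖ < |s| := by
    intro s
    by_cases hs : s = 0
    · exact ⟨abar, fun h => absurd hs h⟩
    · have hmem : F abar + s • v ∈ closure (F '' D) := hcl ▸ Set.mem_univ _
      obtain ⟨_, ⟨β, hβ, rfl⟩, hdist⟩ := Metric.mem_closure_iff.1 hmem |s| (abs_pos.2 hs)
      exact ⟨β, fun _ => ⟨hβ, by rwa [dist_comm, dist_eq_norm] at hdist⟩⟩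
  choose af haf using hnear
  refine ⟨fun α _ => by simp, ?_, ?_, af, ?_, ?_, by simp⟩
  · have hcont : Continuous fun s : ℝ => F abar + s • v := by fun_prop
    simpa using hcont.tendsto 0
  · intro s hs α hα hmin
    obtain ⟨hD', hlt⟩ := haf s hs
    have hle : ‖F α - (F abar + s • v)‖ ^ 2 ≤ ‖F (af s) - (F abar + s • v)‖ ^ 2 := hmin hD'
    have hle' := (pow_le_pow_iff_left₀ (norm_nonneg _) (norm_nonneg _) two_ne_zero).1 hle
    exact ((hlower s α hα).trans hle').not_gt hlt
  · intro s hs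
    exact ⟨(haf s hs).1, fun hmem => (hlower s _ hmem).not_gt (haf s hs).2⟩
  · have hbound : Tendsto (fun s : ℝ => (2 * |s|) ^ 2) (nhdsWithin 0 {0}ᶜ) (nhds 0) := by
      have hcont : Continuous fun s : ℝ => (2 * |s|) ^ 2 := by fun_prop
      simpa using (hcont.tendsto 0).mono_left nhdsWithin_le_nhds
    refine squeeze_zero' (Eventually.of_forall fun s => by positivity) ?_ hbound
    filter_upwards [self_mem_nhdsWithin] with s hs
    gcongr
    calc ‖F (af s) - F abar‖ = ‖(F (af s) - (F abar + s • v)) + s • v‖ := by congr 1; abel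
      _ ≤ ‖F (af s) - (F abar + s • v)‖ + ‖s • v‖ := norm_add_le _ _
      _ ≤ |s| + |s| := by
        gcongr
        · exact (haf s hs).2.le
        · simp [norm_smul, hv1]
      _ = 2 * |s| := by ring
end
end

section
/- Polynomial first- and second-order approximations for schemes with a linear lowest level: let β̄ ∈ ℝ^p. (i) If φ is differentiable at (β̄, 0) then there exists a linear subspace V₁ of Y with dim V₁ ≤ d_y·(d_x + 1) such that Ψ(β̄, 0) + DΨ(β̄, 0)[h] ∈ V₁ for every h ∈ ℝ^p × ℝ^{q×d_x}, where DΨ(β̄, 0) is the derivative of Ψ at (β̄, 0). (ii) If moreover φ is continuously differentiable on an open neighborhood of (β̄, 0) and twice differentiable at (β̄, 0), then there exist linear subspaces V₁ ⊆ V₂ of Y with dim V₁ ≤ d_y·(d_x + 1) and dim V₂ ≤ (1/2)·d_y·(d_x + 2)·(d_x + 1) such that Ψ(β̄, 0) + DΨ(β̄, 0)[h] ∈ V₁ and Ψ(β̄, 0) + DΨ(β̄, 0)[h] + (1/2)·D²Ψ(β̄, 0)[h, h] ∈ V₂ for every h ∈ ℝ^p × ℝ^{q×d_x}. -/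
noncomputable section

/-- The norm `‖y‖_Y = ((1/(2n)) · Σ_k ‖y_k‖₂²)^{1/2}` on `Y = (ℝ^{d_y})^n`. -/
def normY {dy n : ℕ} (y : Fin n → Fin dy → ℝ) : ℝ :=
  Real.sqrt (1 / (2 * (n : ℝ)) * ∑ k, ∑ j, y k j ^ 2)

/-- The approximation scheme with linear lowest level:
`Ψ(β, A) = (φ(β, A·x^k))_{k=1}^n`. -/
def PsiLin {dx dy n p q : ℕ} (x : Fin n → Fin dx → ℝ)
    (φ : (Fin p → ℝ) × (Fin q → ℝ) → Fin dy → ℝ)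
    (α : (Fin p → ℝ) × (Fin q → Fin dx → ℝ)) : Fin n → Fin dy → ℝ :=
  fun k => φ (α.1, fun i => ∑ j, α.2 i j * x k j)

/-- The regularized squared loss `α ↦ ‖Ψ(α) − y‖_Y² + ν·g(α − ᾱ)`. -/
def regLoss {dx dy n p q : ℕ} (x : Fin n → Fin dx → ℝ)
    (φ : (Fin p → ℝ) × (Fin q → ℝ) → Fin dy → ℝ)
    (g : (Fin p → ℝ) × (Fin q → Fin dx → ℝ) → ℝ)
    (abar : (Fin p → ℝ) × (Fin q → Fin dx → ℝ)) (ν : ℝ)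
    (y : Fin n → Fin dy → ℝ) (α : (Fin p → ℝ) × (Fin q → Fin dx → ℝ)) : ℝ :=
  normY (PsiLin x φ α - y) ^ 2 + ν * g (α - abar)

/-- The linear map sending coefficient vectors `c` to the values `(∑ s, m k s • c s)_k` of the
corresponding combination of the features `m`. -/
def featureMap {κ ι F : Type*} [Fintype ι] [AddCommGroup F] [Module ℝ F] (m : κ → ι → ℝ) :
    (ι → F) →ₗ[ℝ] (κ → F) where
  toFun c k := ∑ s, m k s • c s
  map_add' c d := by
    ext k
    simp [Finset.sum_add_distrib]
  map_smul' r c := by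
    ext k
    simp only [Pi.smul_apply, RingHom.id_apply, Finset.smul_sum, smul_comm r]

theorem feature_smul_mem_range_featureMap {κ ι F : Type*} [Fintype ι] [AddCommGroup F]
    [Module ℝ F] (m : κ → ι → ℝ) (s : ι) (v : F) :
    (fun k => m k s • v) ∈ LinearMap.range (featureMap (F := F) m) := by
  classical
  refine ⟨Pi.single s v, ?_⟩
  ext k
  simp [featureMap, Pi.single_apply]

theorem finrank_range_featureMap_le {κ ι : Type*} [Fintype ι] (d : ℕ) (m : κ → ι → ℝ) :
    Module.finrank ℝ (LinearMap.range (featureMap (F := Fin d → ℝ) m)) ≤ Fintype.card ι * d := by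
  refine (LinearMap.finrank_range_le _).trans ?_
  simp [Module.finrank_pi_fintype]

section Family

variable {κ E E' F : Type*} [NormedAddCommGroup E] [NormedSpace ℝ E]
  [NormedAddCommGroup E'] [NormedSpace ℝ E'] [NormedAddCommGroup F] [NormedSpace ℝ F]

theorem hasFDerivAt_family_comp_clm [Finite κ] {φ : E' → F} {L : κ → E →L[ℝ] E'} {a : E}
    (h : ∀ k, DifferentiableAt ℝ φ (L k a)) :
    HasFDerivAt (fun α k => φ (L k α))
      (ContinuousLinearMap.pi fun k => (fderiv ℝ φ (L k a)).comp (L k)) a :=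
  hasFDerivAt_pi.2 fun k => (h k).hasFDerivAt.comp a (L k).hasFDerivAt

theorem fderiv_fderiv_family_comp_clm_apply [Fintype κ] {φ : E' → F} {L : κ → E →L[ℝ] E'} {a : E}
    (h : ∀ k, ∀ᶠ b in nhds (L k a), DifferentiableAt ℝ φ b)
    (h' : ∀ k, DifferentiableAt ℝ (fderiv ℝ φ) (L k a)) (u v : E) (k : κ) :
    fderiv ℝ (fderiv ℝ fun α k => φ (L k α)) a u v k =
      fderiv ℝ (fderiv ℝ φ) (L k a) (L k u) (L k v) := by
  classical
  have hev : (fderiv ℝ fun α k => φ (L k α)) =ᶠ[nhds a] fun α =>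
      ∑ k, (ContinuousLinearMap.single ℝ (fun _ : κ => F) k).comp
        ((fderiv ℝ φ (L k α)).comp (L k)) := by
    filter_upwards [Filter.eventually_all.2 fun k => (L k).continuous.continuousAt.eventually (h k)]
      with α hα
    rw [(hasFDerivAt_family_comp_clm hα).fderiv]
    ext w l
    simp [Pi.single_apply]
  have hcomp (k : κ) : HasFDerivAt (fun α => fderiv ℝ φ (L k α))
      ((fderiv ℝ (fderiv ℝ φ) (L k a)).comp (L k)) a :=
    (h' k).hasFDerivAt.comp a (L k).hasFDerivAt
  have hsum : DifferentiableAt ℝ (fun α =>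
      ∑ k, (ContinuousLinearMap.single ℝ (fun _ : κ => F) k).comp
        ((fderiv ℝ φ (L k α)).comp (L k))) a :=
    DifferentiableAt.fun_sum fun k _ => (differentiableAt_const _).clm_comp
      ((hcomp k).differentiableAt.clm_comp (differentiableAt_const _))
  have hdiff : DifferentiableAt ℝ (fderiv ℝ fun α k => φ (L k α)) a :=
    hsum.congr_of_eventuallyEq hev
  have heval : HasFDerivAt (fun α => (fderiv ℝ (fun α k => φ (L k α)) α) v k)
      ((ContinuousLinearMap.proj (R := ℝ) (φ := fun _ : κ => F) k).comp
        ((ContinuousLinearMap.apply ℝ (κ → F) v).comp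
          (fderiv ℝ (fderiv ℝ fun α k => φ (L k α)) a))) a :=
    (ContinuousLinearMap.proj (R := ℝ) (φ := fun _ : κ => F) k).hasFDerivAt.comp a
      ((ContinuousLinearMap.apply ℝ (κ → F) v).hasFDerivAt.comp a hdiff.hasFDerivAt)
  have heval' : HasFDerivAt (fun α => (fderiv ℝ (fun α k => φ (L k α)) α) v k)
      ((ContinuousLinearMap.apply ℝ F (L k v)).comp
        ((fderiv ℝ (fderiv ℝ φ) (L k a)).comp (L k))) a := by
    refine ((ContinuousLinearMap.apply ℝ F (L k v)).hasFDerivAt.comp a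
      (hcomp k)).congr_of_eventuallyEq ?_
    filter_upwards [hev] with α hα
    simp [hα, Pi.single_apply]
  simpa using congrArg (fun T => T u) (heval.unique heval')

end Family

/-- The linear map `(β, A) ↦ (β, A z)`. -/
def lowestLevel {dx : ℕ} (p q : ℕ) (z : Fin dx → ℝ) :
    (Fin p → ℝ) × (Fin q → Fin dx → ℝ) →L[ℝ] (Fin p → ℝ) × (Fin q → ℝ) :=
  LinearMap.toContinuousLinearMap
    { toFun α := (α.1, fun i => ∑ j, α.2 i j * z j)
      map_add' α α' := by
        ext <;> simp [add_mul, Finset.sum_add_distrib]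
      map_smul' r α := by
        ext <;> simp [Finset.mul_sum, mul_assoc] }

@[simp]
theorem lowestLevel_apply {dx p q : ℕ} (z : Fin dx → ℝ)
    (α : (Fin p → ℝ) × (Fin q → Fin dx → ℝ)) :
    lowestLevel p q z α = (α.1, fun i => ∑ j, α.2 i j * z j) := rfl

theorem lowestLevel_base {dx p q : ℕ} (z : Fin dx → ℝ) (β : Fin p → ℝ) :
    lowestLevel p q z (β, 0) = (β, 0) := by
  ext <;> simp

theorem PsiLin_eq {dx dy n p q : ℕ} (x : Fin n → Fin dx → ℝ)
    (φ : (Fin p → ℝ) × (Fin q → ℝ) → Fin dy → ℝ) :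
    PsiLin x φ = fun α k => φ (lowestLevel p q (x k) α) := rfl

/-- The affine features `(1, z₁, …, z_d)` of `z`. -/
def affineFeature {dx : ℕ} (z : Fin dx → ℝ) (j : Option (Fin dx)) : ℝ := j.elim 1 z

/-- The quadratic features of `z`: products of two affine features. -/
def quadraticFeature {dx : ℕ} (z : Fin dx → ℝ) (s : Sym2 (Option (Fin dx))) : ℝ :=
  (s.map (affineFeature z)).mul

/-- The components of a parameter `(β, A)`: `(β, 0)` and `(0, A_j)` for the columns `A_j`. -/
def parameterComponent {dx p q : ℕ} (h : (Fin p → ℝ) × (Fin q → Fin dx → ℝ))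
    (j : Option (Fin dx)) : (Fin p → ℝ) × (Fin q → ℝ) :=
  j.elim (h.1, 0) fun j => (0, fun i => h.2 i j)

theorem lowestLevel_eq_sum {dx p q : ℕ} (z : Fin dx → ℝ)
    (h : (Fin p → ℝ) × (Fin q → Fin dx → ℝ)) :
    lowestLevel p q z h = ∑ j, affineFeature z j • parameterComponent h j := by
  ext i <;>
    simp [affineFeature, parameterComponent, Prod.fst_sum, Prod.snd_sum, Finset.sum_apply, mul_comm]

theorem const_mem_range_affineFeature {dx n : ℕ} {F : Type*} [AddCommGroup F] [Module ℝ F]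
    (x : Fin n → Fin dx → ℝ) (v : F) :
    (fun _ => v) ∈ LinearMap.range (featureMap (F := F) fun k => affineFeature (x k)) := by
  simpa [affineFeature] using
    feature_smul_mem_range_featureMap (fun k => affineFeature (x k)) none v

theorem range_affineFeature_le {dx n : ℕ} {F : Type*} [AddCommGroup F] [Module ℝ F]
    (x : Fin n → Fin dx → ℝ) :
    LinearMap.range (featureMap (F := F) fun k => affineFeature (x k)) ≤
      LinearMap.range (featureMap (F := F) fun k => quadraticFeature (x k)) := by
  rintro _ ⟨c, rfl⟩
  have hc : featureMap (fun k => affineFeature (x k)) c =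
      ∑ j, fun k => quadraticFeature (x k) s(none, j) • c j := by
    ext k
    simp [featureMap, quadraticFeature, affineFeature, Finset.sum_apply]
  rw [hc]
  exact Submodule.sum_mem _ fun j _ =>
    feature_smul_mem_range_featureMap (fun k => quadraticFeature (x k)) s(none, j) (c j)

theorem first_order_mem {dx dy n p q : ℕ} (x : Fin n → Fin dx → ℝ)
    {φ : (Fin p → ℝ) × (Fin q → ℝ) → Fin dy → ℝ} {β : Fin p → ℝ}
    (hφ : DifferentiableAt ℝ φ (β, (0 : Fin q → ℝ)))
    (h : (Fin p → ℝ) × (Fin q → Fin dx → ℝ)) :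
    PsiLin x φ (β, 0) + fderiv ℝ (PsiLin x φ) (β, 0) h ∈
      LinearMap.range (featureMap (F := Fin dy → ℝ) fun k => affineFeature (x k)) := by
  have hconst : PsiLin x φ (β, 0) = fun _ => φ (β, 0) := by
    ext k
    simp only [PsiLin_eq, lowestLevel_base]
  have hlin : fderiv ℝ (PsiLin x φ) (β, 0) h =
      featureMap (fun k => affineFeature (x k))
        (fun j => fderiv ℝ φ (β, 0) (parameterComponent h j)) := by
    rw [PsiLin_eq, (hasFDerivAt_family_comp_clm fun k => by rwa [lowestLevel_base]).fderiv]
    funext k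
    simp only [ContinuousLinearMap.coe_pi', ContinuousLinearMap.comp_apply, lowestLevel_base]
    rw [lowestLevel_eq_sum]
    simp [featureMap, map_sum, map_smul]
  rw [hconst, hlin]
  exact Submodule.add_mem _ (const_mem_range_affineFeature x _) (LinearMap.mem_range_self _ _)

theorem second_derivative_mem {dx dy n p q : ℕ} (x : Fin n → Fin dx → ℝ)
    {φ : (Fin p → ℝ) × (Fin q → ℝ) → Fin dy → ℝ} {β : Fin p → ℝ}
    (hφ : ∀ᶠ b in nhds (β, (0 : Fin q → ℝ)), DifferentiableAt ℝ φ b)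
    (hφ' : DifferentiableAt ℝ (fderiv ℝ φ) (β, (0 : Fin q → ℝ)))
    (h : (Fin p → ℝ) × (Fin q → Fin dx → ℝ)) :
    fderiv ℝ (fderiv ℝ (PsiLin x φ)) (β, 0) h h ∈
      LinearMap.range (featureMap (F := Fin dy → ℝ) fun k => quadraticFeature (x k)) := by
  have hquad : fderiv ℝ (fderiv ℝ (PsiLin x φ)) (β, 0) h h =
      ∑ i, ∑ j, fun k => quadraticFeature (x k) s(j, i) •
        fderiv ℝ (fderiv ℝ φ) (β, 0) (parameterComponent h j) (parameterComponent h i) := by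
    funext k
    rw [PsiLin_eq, fderiv_fderiv_family_comp_clm_apply
      (fun k => by rwa [lowestLevel_base]) (fun k => by rwa [lowestLevel_base]),
      lowestLevel_base, lowestLevel_eq_sum]
    simp only [map_sum, map_smul, sum_apply, smul_apply,
      Finset.sum_apply, quadraticFeature, Sym2.map_mk, Sym2.mul_mk, Finset.smul_sum, smul_smul]
    simp only [mul_comm]
  rw [hquad]
  exact Submodule.sum_mem _ fun i _ => Submodule.sum_mem _ fun j _ =>
    feature_smul_mem_range_featureMap (fun k => quadraticFeature (x k)) s(j, i) _

theorem finrank_range_affineFeature_le {dx n : ℕ} (dy : ℕ) (x : Fin n → Fin dx → ℝ) :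
    Module.finrank ℝ (LinearMap.range
      (featureMap (F := Fin dy → ℝ) fun k => affineFeature (x k))) ≤ dy * (dx + 1) := by
  refine (finrank_range_featureMap_le dy _).trans_eq ?_
  simp [mul_comm]

theorem finrank_range_quadraticFeature_le {dx n : ℕ} (dy : ℕ) (x : Fin n → Fin dx → ℝ) :
    (Module.finrank ℝ (LinearMap.range
      (featureMap (F := Fin dy → ℝ) fun k => quadraticFeature (x k))) : ℝ) ≤
      ((dy : ℝ) * ((dx : ℝ) + 2) * ((dx : ℝ) + 1)) / 2 := by
  refine (Nat.cast_le.2 (finrank_range_featureMap_le dy _)).trans_eq ?_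
  rw [Sym2.card, Nat.cast_mul, Nat.cast_choose_two]
  simp
  ring

theorem polynomial_taylor_subspaces
    (dx dy n p q : ℕ) (hn : 2 ≤ n) (hdx : 1 ≤ dx) (hdy : 1 ≤ dy)
    (hp : 1 ≤ p) (hq : 1 ≤ q)
    (x : Fin n → Fin dx → ℝ)
    (φ : (Fin p → ℝ) × (Fin q → ℝ) → Fin dy → ℝ)
    (βbar : Fin p → ℝ) :
    (DifferentiableAt ℝ φ (βbar, (0 : Fin q → ℝ)) →
      ∃ V₁ : Submodule ℝ (Fin n → Fin dy → ℝ),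
        Module.finrank ℝ V₁ ≤ dy * (dx + 1) ∧
        ∀ h : (Fin p → ℝ) × (Fin q → Fin dx → ℝ),
          PsiLin x φ (βbar, 0) + fderiv ℝ (PsiLin x φ) (βbar, 0) h ∈ V₁) ∧
    ((∃ U : Set ((Fin p → ℝ) × (Fin q → ℝ)),
        IsOpen U ∧ (βbar, (0 : Fin q → ℝ)) ∈ U ∧ ContDiffOn ℝ 1 φ U) →
      DifferentiableAt ℝ (fderiv ℝ φ) (βbar, (0 : Fin q → ℝ)) →
      ∃ V₁ V₂ : Submodule ℝ (Fin n → Fin dy → ℝ), V₁ ≤ V₂ ∧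
        Module.finrank ℝ V₁ ≤ dy * (dx + 1) ∧
        (Module.finrank ℝ V₂ : ℝ) ≤ ((dy : ℝ) * ((dx : ℝ) + 2) * ((dx : ℝ) + 1)) / 2 ∧
        (∀ h : (Fin p → ℝ) × (Fin q → Fin dx → ℝ),
          PsiLin x φ (βbar, 0) + fderiv ℝ (PsiLin x φ) (βbar, 0) h ∈ V₁) ∧
        (∀ h : (Fin p → ℝ) × (Fin q → Fin dx → ℝ),
          PsiLin x φ (βbar, 0) + fderiv ℝ (PsiLin x φ) (βbar, 0) h
            + (1 / 2 : ℝ) • fderiv ℝ (fderiv ℝ (PsiLin x φ)) (βbar, 0) h h ∈ V₂)) := by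
  refine ⟨fun hφ => ⟨_, finrank_range_affineFeature_le dy x, first_order_mem x hφ⟩, ?_⟩
  rintro ⟨U, hU, hmem, hcd⟩ hφ'
  have hφ : ∀ᶠ b in nhds (βbar, (0 : Fin q → ℝ)), DifferentiableAt ℝ φ b := by
    filter_upwards [hU.mem_nhds hmem] with b hb
    exact (hcd.contDiffAt (hU.mem_nhds hb)).differentiableAt one_ne_zero
  exact ⟨_, _, range_affineFeature_le x, finrank_range_affineFeature_le dy x,
    finrank_range_quadraticFeature_le dy x, first_order_mem x hφ.self_of_nhds,
    fun h => Submodule.add_mem _ (range_affineFeature_le x (first_order_mem x hφ.self_of_nhds h))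
      (Submodule.smul_mem _ _ (second_derivative_mem x hφ hφ' h))⟩
end
end
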